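/- arXiv:1409.7321 — 4 statements merged into one kernel-verified Lean document; each statement's English description precedes it below -/
import Mathlib

section
/- Let N ≥ 3 be an integer. If φ : ℝ^N → ℝ is a bounded C² function satisfying Δφ(ξ) + p w₀(ξ)^{p-1} φ(ξ) = 0 for all ξ ∈ ℝ^N, then there exist real numbers c₀, c₁, …, c_N such that φ = c₀ Z₀ + Σ_{j=1}^N c_j Z_j. -/
noncomputable section
open Real

/-- The Euclidean Laplacian: sum of the pure second partial derivatives. -/
def lap {N : ℕ} (u : EuclideanSpace ℝ (Fin N) → ℝ) (x : EuclideanSpace ℝ (Fin N)) : ℝ :=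
  ∑ i : Fin N,
    fderiv ℝ (fun y => fderiv ℝ u y (EuclideanSpace.single i 1)) x (EuclideanSpace.single i 1)

/-- The standard bubble `w₀(ξ) = α_N (1+|ξ|²)^{-(N-2)/2}` with `α_N = (N(N-2))^{(N-2)/4}`. -/
def bubble (N : ℕ) (ξ : EuclideanSpace ℝ (Fin N)) : ℝ :=
  ((N : ℝ) * ((N : ℝ) - 2)) ^ (((N : ℝ) - 2) / 4) * (1 + ‖ξ‖ ^ 2) ^ (-(((N : ℝ) - 2) / 2))

/-- `Z_j = ∂w₀/∂ξ_j`. -/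
def Zj (N : ℕ) (j : Fin N) (ξ : EuclideanSpace ℝ (Fin N)) : ℝ :=
  fderiv ℝ (bubble N) ξ (EuclideanSpace.single j 1)

/-- `Z₀(ξ) = ξ·∇w₀(ξ) + ((N-2)/2) w₀(ξ)`. -/
def Z0 (N : ℕ) (ξ : EuclideanSpace ℝ (Fin N)) : ℝ :=
  fderiv ℝ (bubble N) ξ ξ + ((N : ℝ) - 2) / 2 * bubble N ξ

open Filter Topology

def HS {N : ℕ} (u : EuclideanSpace ℝ (Fin N) → ℝ) (x e : EuclideanSpace ℝ (Fin N)) (d : ℝ) : Prop :=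
  ∃ u' : ℝ → ℝ, (∀ᶠ t in 𝓝 (0:ℝ), HasDerivAt (fun t : ℝ => u (x + t • e)) (u' t) t) ∧
    HasDerivAt u' d 0

lemma HS.derivs {N : ℕ} {u : EuclideanSpace ℝ (Fin N) → ℝ} {x e : EuclideanSpace ℝ (Fin N)} {d : ℝ}
    (h : HS u x e d) : deriv (deriv (fun t : ℝ => u (x + t • e))) 0 = d := by
  obtain ⟨u', h1, h2⟩ := h
  have : deriv (fun t : ℝ => u (x + t • e)) =ᶠ[𝓝 0] u' := by
    filter_upwards [h1] with t ht using ht.deriv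
  rw [this.deriv_eq, h2.deriv]

lemma HS.unique {N : ℕ} {u : EuclideanSpace ℝ (Fin N) → ℝ} {x e : EuclideanSpace ℝ (Fin N)}
    {d d' : ℝ} (h : HS u x e d) (h' : HS u x e d') : d = d' := by
  rw [← h.derivs, ← h'.derivs]

lemma HS.sub {N : ℕ} {u v : EuclideanSpace ℝ (Fin N) → ℝ} {x e : EuclideanSpace ℝ (Fin N)}
    {d d' : ℝ} (h : HS u x e d) (h' : HS v x e d') : HS (fun y => u y - v y) x e (d - d') := by
  obtain ⟨u', h1, h2⟩ := h
  obtain ⟨v', k1, k2⟩ := h'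
  refine ⟨fun t => u' t - v' t, ?_, h2.sub k2⟩
  filter_upwards [h1, k1] with t a b using a.sub b

lemma HS.add {N : ℕ} {u v : EuclideanSpace ℝ (Fin N) → ℝ} {x e : EuclideanSpace ℝ (Fin N)}
    {d d' : ℝ} (h : HS u x e d) (h' : HS v x e d') : HS (fun y => u y + v y) x e (d + d') := by
  obtain ⟨u', h1, h2⟩ := h
  obtain ⟨v', k1, k2⟩ := h'
  refine ⟨fun t => u' t + v' t, ?_, h2.add k2⟩
  filter_upwards [h1, k1] with t a b using a.add b

lemma HS.const_mul {N : ℕ} {u : EuclideanSpace ℝ (Fin N) → ℝ} {x e : EuclideanSpace ℝ (Fin N)}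
    {d : ℝ} (c : ℝ) (h : HS u x e d) : HS (fun y => c * u y) x e (c * d) := by
  obtain ⟨u', h1, h2⟩ := h
  refine ⟨fun t => c * u' t, ?_, h2.const_mul c⟩
  filter_upwards [h1] with t a using a.const_mul c

lemma HS.nonpos {N : ℕ} {u : EuclideanSpace ℝ (Fin N) → ℝ} {x e : EuclideanSpace ℝ (Fin N)}
    {d : ℝ} (h : HS u x e d) (hm : IsLocalMax u x) : d ≤ 0 := by
  by_contra hd
  push Not at hd
  have hdd := h.derivs
  obtain ⟨u', h1, h2⟩ := h
  have hc : ContinuousAt (fun t : ℝ => u (x + t • e)) 0 := h1.self_of_nhds.continuousAt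
  have hline : Tendsto (fun t : ℝ => x + t • e) (𝓝 0) (𝓝 x) := by
    have : Continuous (fun t : ℝ => x + t • e) := by fun_prop
    simpa using this.tendsto 0
  have hmax : IsLocalMax (fun t : ℝ => u (x + t • e)) 0 := by
    have := hline.eventually hm
    filter_upwards [this] with t ht
    simpa using ht
  have hmin : IsLocalMin (fun t : ℝ => u (x + t • e)) 0 :=
    isLocalMin_of_deriv_deriv_pos (by rw [hdd]; exact hd) hmax.deriv_eq_zero hc
  have hconst : (fun t : ℝ => u (x + t • e)) =ᶠ[𝓝 0] fun _ => u (x + (0:ℝ) • e) := by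
    filter_upwards [hmax, hmin] with t a b using le_antisymm a b
  have h3 : deriv (fun t : ℝ => u (x + t • e)) =ᶠ[𝓝 0] fun _ => 0 := by
    have := hconst.deriv
    simpa using this
  rw [h3.deriv_eq] at hdd
  simp at hdd
  linarith

lemma HS_of_contDiff {N : ℕ} {u : EuclideanSpace ℝ (Fin N) → ℝ} (hu : ContDiff ℝ 2 u)
    (x e : EuclideanSpace ℝ (Fin N)) : HS u x e (fderiv ℝ (fderiv ℝ u) x e e) := by
  have hd : Differentiable ℝ u := hu.differentiable (by norm_num)
  have hd2 : Differentiable ℝ (fderiv ℝ u) :=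
    (hu.fderiv_right (m := 1) (by norm_num)).differentiable (by norm_num)
  have hl : ∀ t : ℝ, HasDerivAt (fun t : ℝ => x + t • e) e t := by
    intro t
    simpa using ((hasDerivAt_id t).smul_const e).const_add x
  refine ⟨fun t => fderiv ℝ u (x + t • e) e, Eventually.of_forall fun t => ?_, ?_⟩
  · exact (hd _).hasFDerivAt.comp_hasDerivAt t (hl t)
  · have h1 : HasDerivAt (fun t : ℝ => fderiv ℝ u (x + t • e)) (fderiv ℝ (fderiv ℝ u) x e) 0 := by
      have := (hd2 (x + (0:ℝ) • e)).hasFDerivAt.comp_hasDerivAt 0 (hl 0)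
      simp only [zero_smul, add_zero] at this
      exact this
    have := h1.clm_apply (hasDerivAt_const (0:ℝ) e)
    simpa using this

lemma lap_eq_sum {N : ℕ} {u : EuclideanSpace ℝ (Fin N) → ℝ} (hu : ContDiff ℝ 2 u)
    (x : EuclideanSpace ℝ (Fin N)) : lap u x = ∑ i : Fin N,
      fderiv ℝ (fderiv ℝ u) x (EuclideanSpace.single i 1) (EuclideanSpace.single i 1) := by
  have hd2 : Differentiable ℝ (fderiv ℝ u) :=
    (hu.fderiv_right (m := 1) (by norm_num)).differentiable (by norm_num)
  unfold lap
  refine Finset.sum_congr rfl fun i _ => ?_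
  rw [fderiv_clm_apply (hd2 x) (by fun_prop)]
  simp

lemma lap_eq_of_HS {N : ℕ} {u : EuclideanSpace ℝ (Fin N) → ℝ} (hu : ContDiff ℝ 2 u)
    (x : EuclideanSpace ℝ (Fin N)) {d : Fin N → ℝ}
    (h : ∀ i, HS u x (EuclideanSpace.single i 1) (d i)) : lap u x = ∑ i, d i := by
  rw [lap_eq_sum hu]
  exact Finset.sum_congr rfl fun i _ => (HS_of_contDiff hu _ _).unique (h i)

open InnerProductSpace in
lemma lap_eq_laplacian {N : ℕ} {u : EuclideanSpace ℝ (Fin N) → ℝ} (hu : ContDiff ℝ 2 u)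
    (x : EuclideanSpace ℝ (Fin N)) (b : OrthonormalBasis (Fin N) ℝ (EuclideanSpace ℝ (Fin N))) :
    lap u x = ∑ i : Fin N, fderiv ℝ (fderiv ℝ u) x (b i) (b i) := by
  rw [lap_eq_sum hu]
  have h1 := congrFun (laplacian_eq_iteratedFDeriv_orthonormalBasis u b) x
  have h2 := congrFun (laplacian_eq_iteratedFDeriv_orthonormalBasis u
    (EuclideanSpace.basisFun (Fin N) ℝ)) x
  rw [h1] at h2
  simpa [iteratedFDeriv_two_apply] using h2.symm

lemma lap_comp {N : ℕ} {u : EuclideanSpace ℝ (Fin N) → ℝ} (hu : ContDiff ℝ 2 u)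
    (σ : EuclideanSpace ℝ (Fin N) ≃ₗᵢ[ℝ] EuclideanSpace ℝ (Fin N))
    (x : EuclideanSpace ℝ (Fin N)) : lap (fun y => u (σ y)) x = lap u (σ x) := by
  have hc : ContDiff ℝ 2 (fun y => u (σ y)) := hu.comp σ.contDiff
  rw [lap_eq_laplacian hu (σ x) ((EuclideanSpace.basisFun (Fin N) ℝ).map σ)]
  apply lap_eq_of_HS hc
  intro i
  have := HS_of_contDiff hu (σ x) (σ (EuclideanSpace.single i 1))
  simpa [HS, map_add, map_smul] using this

lemma line_norm {N : ℕ} (x : EuclideanSpace ℝ (Fin N)) (i : Fin N) (t : ℝ) :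
    ‖x + t • EuclideanSpace.single i (1:ℝ)‖ ^ 2 = ‖x‖ ^ 2 + 2 * t * x i + t ^ 2 := by
  rw [norm_add_sq_real, real_inner_smul_right, norm_smul]
  simp [EuclideanSpace.inner_single_right]
  ring

lemma line_inner {N : ℕ} (a x : EuclideanSpace ℝ (Fin N)) (i : Fin N) (t : ℝ) :
    inner ℝ a (x + t • EuclideanSpace.single i (1:ℝ)) = inner ℝ a x + t * a i := by
  rw [inner_add_right, real_inner_smul_right]
  simp [EuclideanSpace.inner_single_right]

/-- second derivatives of `A(⟨a,x⟩) g(|x|²)` -/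
lemma HS_prod {N : ℕ} (a x : EuclideanSpace ℝ (Fin N)) (i : Fin N) (A A' g g' : ℝ → ℝ) (A2 g2 : ℝ)
    (hA : ∀ᶠ y in 𝓝 (inner ℝ a x), HasDerivAt A (A' y) y) (hA2 : HasDerivAt A' A2 (inner ℝ a x))
    (hg : ∀ᶠ y in 𝓝 (‖x‖ ^ 2), HasDerivAt g (g' y) y) (hg2 : HasDerivAt g' g2 (‖x‖ ^ 2)) :
    HS (fun y => A (inner ℝ a y) * g (‖y‖ ^ 2)) x (EuclideanSpace.single i 1)
      (A2 * g (‖x‖ ^ 2) * (a i * a i) + 4 * A' (inner ℝ a x) * g' (‖x‖ ^ 2) * (a i * x i)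
        + A (inner ℝ a x) * (4 * g2 * (x i * x i) + 2 * g' (‖x‖ ^ 2))) := by
  have hX : ∀ t : ℝ, HasDerivAt (fun t : ℝ => inner ℝ a x + t * a i) (a i) t := by
    intro t
    simpa using ((hasDerivAt_id t).mul_const (a i)).const_add (inner ℝ a x)
  have hS : ∀ t : ℝ, HasDerivAt (fun t : ℝ => ‖x‖ ^ 2 + 2 * t * x i + t ^ 2)
      (2 * x i + 2 * t) t := by
    intro t
    have h1 := (((hasDerivAt_id t).const_mul 2).mul_const (x i)).const_add (‖x‖ ^ 2)
    have h2 := h1.add ((hasDerivAt_id t).pow 2)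
    simp only [id, mul_one, Nat.cast_ofNat, Nat.add_one_sub_one, pow_one] at h2
    exact h2
  have hX0 : Tendsto (fun t : ℝ => inner ℝ a x + t * a i) (𝓝 0) (𝓝 (inner ℝ a x)) := by
    simpa using (hX 0).continuousAt.tendsto
  have hS0 : Tendsto (fun t : ℝ => ‖x‖ ^ 2 + 2 * t * x i + t ^ 2) (𝓝 0) (𝓝 (‖x‖ ^ 2)) := by
    simpa using (hS 0).continuousAt.tendsto
  refine ⟨fun t => A' (inner ℝ a x + t * a i) * a i * g (‖x‖ ^ 2 + 2 * t * x i + t ^ 2)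
    + A (inner ℝ a x + t * a i) * (g' (‖x‖ ^ 2 + 2 * t * x i + t ^ 2) * (2 * x i + 2 * t)), ?_, ?_⟩
  · filter_upwards [hX0.eventually hA, hS0.eventually hg] with t h1 h2
    simp only [line_norm, line_inner]
    exact (h1.comp t (hX t)).mul (h2.comp t (hS t))
  · have hA0 : HasDerivAt (fun t : ℝ => A (inner ℝ a x + t * a i)) (A' (inner ℝ a x) * a i) 0 := by
      have := hA.self_of_nhds
      refine HasDerivAt.comp (h₂ := A) 0 ?_ (hX 0)
      simpa using this
    have hA0' : HasDerivAt (fun t : ℝ => A' (inner ℝ a x + t * a i)) (A2 * a i) 0 := by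
      refine HasDerivAt.comp (h₂ := A') 0 ?_ (hX 0)
      simpa using hA2
    have hg0 : HasDerivAt (fun t : ℝ => g (‖x‖ ^ 2 + 2 * t * x i + t ^ 2))
        (g' (‖x‖ ^ 2) * (2 * x i + 2 * 0)) 0 := by
      refine HasDerivAt.comp (h₂ := g) 0 ?_ (hS 0)
      simpa using hg.self_of_nhds
    have hg0' : HasDerivAt (fun t : ℝ => g' (‖x‖ ^ 2 + 2 * t * x i + t ^ 2))
        (g2 * (2 * x i + 2 * 0)) 0 := by
      refine HasDerivAt.comp (h₂ := g') 0 ?_ (hS 0)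
      simpa using hg2
    have hl : HasDerivAt (fun t : ℝ => 2 * x i + 2 * t) 2 0 := by
      simpa using ((hasDerivAt_id (0:ℝ)).const_mul 2).const_add (2 * x i)
    have := ((hA0'.mul_const (a i)).mul hg0).add (hA0.mul (hg0'.mul hl))
    refine HasDerivAt.congr_deriv this ?_
    simp only [zero_mul, mul_zero, add_zero, ne_eq, OfNat.ofNat_ne_zero, not_false_eq_true, zero_pow,
      Pi.mul_apply]
    ring

lemma sum_aa {N : ℕ} (a x : EuclideanSpace ℝ (Fin N)) : ∑ i, a i * x i = inner ℝ a x := by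
  simp [PiLp.inner_apply, mul_comm]

lemma sum_xx {N : ℕ} (x : EuclideanSpace ℝ (Fin N)) : ∑ i, x i * x i = ‖x‖ ^ 2 := by
  rw [sum_aa, real_inner_self_eq_norm_sq]

lemma sum_prod {N : ℕ} (a x : EuclideanSpace ℝ (Fin N)) (p q q' r s : ℝ) :
    ∑ i, (p * (a i * a i) + q * (a i * x i) + r * (4 * s * (x i * x i) + 2 * q')) =
      p * ‖a‖ ^ 2 + q * inner ℝ a x + r * (4 * s * ‖x‖ ^ 2 + 2 * N * q') := by
  simp only [Finset.sum_add_distrib, ← Finset.mul_sum, sum_aa, real_inner_self_eq_norm_sq,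
    Finset.sum_const, Finset.card_univ, Fintype.card_fin, nsmul_eq_mul]
  ring

lemma flat_bound {N : ℕ} {f : EuclideanSpace ℝ (Fin N) → ℝ} (hf : ContDiff ℝ 2 f)
    {a : EuclideanSpace ℝ (Fin N)} (ha : ‖a‖ = 1) (h0 : ∀ x, inner ℝ a x = 0 → f x = 0)
    {R C : ℝ} (hC : ∀ y, ‖y‖ ≤ R → |fderiv ℝ f y a| ≤ C) (x : EuclideanSpace ℝ (Fin N))
    (hx : ‖x‖ ≤ R) (hX : 0 ≤ inner ℝ a x) : |f x| ≤ C * inner ℝ a x := by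
  set X : ℝ := inner ℝ a x with hXdef
  have hd : Differentiable ℝ f := hf.differentiable (by norm_num)
  have haa : inner ℝ a a = 1 := by rw [real_inner_self_eq_norm_sq, ha]; norm_num
  have hl : ∀ t : ℝ, HasDerivAt (fun t : ℝ => (x - X • a) + t • a) a t := by
    intro t
    simpa using ((hasDerivAt_id t).smul_const a).const_add (x - X • a)
  have hn : ∀ t : ℝ, 0 ≤ t → t ≤ X → ‖(x - X • a) + t • a‖ ≤ R := by
    intro t ht htX
    refine le_trans ?_ hx
    have e1 : (x - X • a) + t • a = x + (t - X) • a := by rw [sub_smul]; abel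
    rw [e1]
    apply abs_le_of_sq_le_sq' _ (norm_nonneg _) |>.2
    rw [norm_add_sq_real, real_inner_smul_right, norm_smul, real_inner_comm, ← hXdef, ha]
    simp only [Real.norm_eq_abs, mul_one, sq_abs]
    nlinarith
  have key := norm_image_sub_le_of_norm_deriv_le_segment' (f := fun t : ℝ => f ((x - X • a) + t • a))
    (f' := fun t => fderiv ℝ f ((x - X • a) + t • a) a) (a := 0) (b := X) (C := C)
    (fun t _ => ((hd _).hasFDerivAt.comp_hasDerivAt t (hl t)).hasDerivWithinAt)
    (fun t ht => by
      rw [Real.norm_eq_abs]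
      exact hC _ (hn t ht.1 ht.2.le)) X ⟨hX, le_rfl⟩
  have e0 : f ((x - X • a) + (0:ℝ) • a) = 0 := by
    apply h0
    rw [zero_smul, add_zero, inner_sub_right, real_inner_smul_right, haa, ← hXdef]; ring
  rw [e0] at key
  simpa using key

lemma maxp {N : ℕ} {K : Set (EuclideanSpace ℝ (Fin N))} (hK : IsCompact K)
    {u : EuclideanSpace ℝ (Fin N) → ℝ} (hu : ContinuousOn u K) {b : ℝ}
    (h : ∀ y ∈ K, u y ≤ b ∨ (K ∈ 𝓝 y ∧ ∃ d : Fin N → ℝ,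
      (∀ i, HS u y (EuclideanSpace.single i 1) (d i)) ∧ 0 < ∑ i, d i)) :
    ∀ x ∈ K, u x ≤ b := by
  intro x hx
  obtain ⟨y, hy, hmax⟩ := hK.exists_isMaxOn ⟨x, hx⟩ hu
  rcases h y hy with h1 | ⟨hn, d, hd, hpos⟩
  · exact (hmax hx).trans h1
  · exfalso
    have hloc : IsLocalMax u y := hmax.isLocalMax hn
    have : ∑ i, d i ≤ 0 := Finset.sum_nonpos fun i _ => (hd i).nonpos hloc
    linarith

lemma inner_le_norm' {N : ℕ} {a : EuclideanSpace ℝ (Fin N)} (ha : ‖a‖ = 1)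
    (x : EuclideanSpace ℝ (Fin N)) : inner ℝ a x ≤ ‖x‖ := by
  have := real_inner_le_norm a x
  rwa [ha, one_mul] at this

lemma HS_quad {N : ℕ} (a x0 y : EuclideanSpace ℝ (Fin N)) (i : Fin N) (m p q : ℝ) :
    HS (fun y => m * (‖y - x0‖ ^ 2 - p * (inner ℝ a y) ^ 2 + q * inner ℝ a y)) y
      (EuclideanSpace.single i 1) (m * (2 - 2 * p * (a i * a i))) := by
  refine ⟨fun t => m * (2 * (y - x0) i + 2 * t - p * (2 * (inner ℝ a y + t * a i) * a i) + q * a i),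
    Eventually.of_forall fun t => ?_, ?_⟩
  · have e : ∀ t : ℝ, m * (‖(y + t • EuclideanSpace.single i (1:ℝ)) - x0‖ ^ 2
        - p * (inner ℝ a (y + t • EuclideanSpace.single i (1:ℝ))) ^ 2
        + q * inner ℝ a (y + t • EuclideanSpace.single i (1:ℝ))) =
        m * (‖y - x0‖ ^ 2 + 2 * t * (y - x0) i + t ^ 2 - p * (inner ℝ a y + t * a i) ^ 2
          + q * (inner ℝ a y + t * a i)) := by
      intro t
      rw [line_inner, add_sub_right_comm, line_norm]
    simp only [e]
    have hid := hasDerivAt_id t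
    have hX := (hid.mul_const (a i)).const_add (inner ℝ a y)
    have h1 := ((((((hid.const_mul 2).mul_const ((y - x0) i)).const_add (‖y - x0‖ ^ 2)).add
      (hid.pow 2)).sub ((hX.pow 2).const_mul p)).add (hX.const_mul q)).const_mul m
    refine HasDerivAt.congr_deriv h1 ?_
    simp
  · have hid := hasDerivAt_id (0:ℝ)
    have hX := (hid.mul_const (a i)).const_add (inner ℝ a y)
    have h1 := ((((hid.const_mul 2).const_add (2 * (y - x0) i)).sub
      (((hX.const_mul 2).mul_const (a i)).const_mul p)).add (hasDerivAt_const (0:ℝ) (q * a i))).const_mul m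
    refine HasDerivAt.congr_deriv h1 ?_
    ring

lemma infty_bound {N : ℕ} {f : EuclideanSpace ℝ (Fin N) → ℝ} (hN : 3 ≤ N) (hf : ContDiff ℝ 2 f)
    (hs : ∀ x, lap f x + (N:ℝ) * (N + 2) / (1 + ‖x‖ ^ 2) ^ 2 * f x = 0)
    {a : EuclideanSpace ℝ (Fin N)} (ha : ‖a‖ = 1) (h0 : ∀ x, inner ℝ a x = 0 → f x = 0)
    {M : ℝ} (hM0 : 0 < M) (hM : ∀ x, |f x| ≤ M) (x : EuclideanSpace ℝ (Fin N))
    (hx : (N:ℝ) + 2 ≤ ‖x‖) (hX : 0 < inner ℝ a x) :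
    f x ≤ 4 * (2 * N + 1) * M * inner ℝ a x / ‖x‖ := by
  have hN' : (3:ℝ) ≤ N := by exact_mod_cast hN
  set R : ℝ := ‖x‖ with hR
  have hRpos : 0 < R := by linarith
  set X : ℝ := inner ℝ a x with hXdef
  have haa : inner ℝ a a = 1 := by rw [real_inner_self_eq_norm_sq, ha]; norm_num
  rcases le_or_gt (R / 4) X with hc | hc
  · have : f x ≤ M := (le_abs_self _).trans (hM x)
    refine this.trans ?_
    rw [le_div_iff₀ hRpos]
    have : M * R ≤ M * (4 * X) := by gcongr; linarith
    nlinarith [mul_pos hM0 hX, mul_pos (mul_pos hM0 hX) (by linarith : (0:ℝ) < N)]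
  set L : ℝ := R / 4 with hL
  have hLpos : 0 < L := by positivity
  set x0 := x - X • a with hx0
  have hx0a : inner ℝ a x0 = 0 := by
    rw [hx0, inner_sub_right, real_inner_smul_right, haa, ← hXdef]; ring
  have hxx0 : ‖x - x0‖ = X := by
    rw [hx0, sub_sub_cancel, norm_smul, ha, mul_one, Real.norm_eq_abs, abs_of_pos hX]
  have hx0n : 3 * R / 4 ≤ ‖x0‖ := by
    have := norm_sub_norm_le x x0
    rw [hxx0] at this
    linarith
  set K : Set (EuclideanSpace ℝ (Fin N)) := Metric.closedBall x0 L ∩ {y | 0 ≤ inner ℝ a y} with hKdef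
  have hci : Continuous (fun y : EuclideanSpace ℝ (Fin N) => (inner ℝ a y : ℝ)) := by fun_prop
  have hK : IsCompact K :=
    (isCompact_closedBall x0 L).inter_right (isClosed_le continuous_const hci)
  have hxK : x ∈ K := ⟨by rw [Metric.mem_closedBall, dist_eq_norm, hxx0]; exact hc.le, hX.le⟩
  have hmain := maxp (u := fun y => f y - M / L ^ 2 * (‖y - x0‖ ^ 2 - (2 * N) * (inner ℝ a y) ^ 2
      + (2 * N * L) * inner ℝ a y)) (b := 0) hK (by
        have := hf.continuous
        apply Continuous.continuousOn
        fun_prop) ?_ x hxK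
  · have h1 : f x ≤ M / L ^ 2 * (X ^ 2 - 2 * N * X ^ 2 + 2 * N * L * X) := by
      have := hmain
      simp only [hxx0, ← hXdef] at this
      linarith
    refine h1.trans ?_
    have hR4 : R = 4 * L := by rw [hL]; ring
    rw [hR4, div_mul_eq_mul_div, div_le_div_iff₀ (by positivity) (by positivity)]
    have hq : X ^ 2 - 2 * N * X ^ 2 + 2 * N * L * X ≤ (2 * N + 1) * (L * X) := by nlinarith
    have := mul_le_mul_of_nonneg_left hq (by positivity : 0 ≤ M * (4 * L))
    nlinarith
  · rintro y ⟨hy1, hy2⟩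
    rw [Metric.mem_closedBall, dist_eq_norm] at hy1
    change 0 ≤ inner ℝ a y at hy2
    have hfy : f y ≤ M := (le_abs_self _).trans (hM y)
    rcases hy2.eq_or_lt with hy0 | hypos
    · left
      rw [h0 y hy0.symm, ← hy0]
      have : 0 ≤ M / L ^ 2 * (‖y - x0‖ ^ 2) := by positivity
      simp
      linarith
    rcases hy1.eq_or_lt with hyL | hyL
    · left
      have hXL : inner ℝ a y ≤ L := by
        have := inner_le_norm' ha (y - x0)
        rw [inner_sub_right, hx0a, sub_zero, hyL] at this
        exact this
      rw [hyL]
      have : M / L ^ 2 * L ^ 2 ≤ M / L ^ 2 * (L ^ 2 - 2 * N * inner ℝ a y ^ 2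
          + 2 * N * L * inner ℝ a y) := by
        apply mul_le_mul_of_nonneg_left _ (by positivity)
        have : 0 ≤ 2 * N * inner ℝ a y * (L - inner ℝ a y) := by
          apply mul_nonneg (by positivity) (by linarith)
        nlinarith
      rw [div_mul_cancel₀ _ (by positivity)] at this
      linarith
    · right
      refine ⟨?_, ?_⟩
      · apply Filter.inter_mem
        · exact Metric.closedBall_mem_nhds_of_mem (by rwa [Metric.mem_ball, dist_eq_norm])
        · exact (hci.continuousAt.eventually (lt_mem_nhds hypos)).mono fun z hz => le_of_lt hz
      · refine ⟨_, fun i => (HS_of_contDiff hf y _).sub (HS_quad a x0 y i _ _ _), ?_⟩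
        rw [Finset.sum_sub_distrib, ← lap_eq_sum hf y, ← Finset.mul_sum, Finset.sum_sub_distrib,
          ← Finset.mul_sum, sum_xx, ha]
        simp only [Finset.sum_const, Finset.card_univ, Fintype.card_fin, nsmul_eq_mul]
        have hlap := hs y
        have hyn : R / 2 ≤ ‖y‖ := by
          have := norm_sub_norm_le x0 y
          rw [norm_sub_rev x0 y] at this
          linarith
        have hV : (N:ℝ) * (N + 2) / (1 + ‖y‖ ^ 2) ^ 2 * f y ≤ 16 * N * (N + 2) / R ^ 4 * M := by
          have h1 : (N:ℝ) * (N + 2) / (1 + ‖y‖ ^ 2) ^ 2 ≤ 16 * N * (N + 2) / R ^ 4 := by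
            have h2 : (R ^ 2 / 4) ^ 2 ≤ (1 + ‖y‖ ^ 2) ^ 2 := by
              apply pow_le_pow_left₀ (by positivity)
              nlinarith
            have h3 : (N:ℝ) * (N + 2) / (1 + ‖y‖ ^ 2) ^ 2 ≤ (N:ℝ) * (N + 2) / (R ^ 2 / 4) ^ 2 :=
              div_le_div_of_nonneg_left (by positivity) (by positivity) h2
            refine h3.trans (le_of_eq ?_)
            field_simp
            ring
          calc (N:ℝ) * (N + 2) / (1 + ‖y‖ ^ 2) ^ 2 * f y
              ≤ (N:ℝ) * (N + 2) / (1 + ‖y‖ ^ 2) ^ 2 * M := by gcongr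
            _ ≤ _ := by gcongr
        have hlast : 16 * N * (N + 2) / R ^ 4 * M < 32 * N * M / R ^ 2 := by
          rw [div_mul_eq_mul_div, div_lt_div_iff₀ (by positivity) (by positivity)]
          have hRR : (N:ℝ) + 2 < 2 * R ^ 2 := by nlinarith
          have := mul_lt_mul_of_pos_left hRR (by positivity : 0 < 16 * N * M * R ^ 2)
          nlinarith
        have e : M / L ^ 2 * (N * 2 - 2 * (2 * N) * 1 ^ 2) = - (32 * N * M / R ^ 2) := by
          rw [hL]; field_simp; ring
        rw [e]
        linarith

def rho (N : ℕ) (s : ℝ) : ℝ := (1 + s) ^ (-((N:ℝ) / 2))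
def qq (N : ℕ) (s : ℝ) : ℝ := s ^ (-((N:ℝ) / 2) - 1) * (1 + s) ^ N
def BB (N : ℕ) (s0 s : ℝ) : ℝ := ∫ t in s0..s, qq N t
def KK (N : ℕ) (s : ℝ) : ℝ := (1 + s) ^ (N + 1) / ((N:ℝ) + 1)

lemma rho_pos (N : ℕ) {s : ℝ} (hs : 0 ≤ s) : 0 < rho N s := by
  unfold rho; positivity

lemma rho_anti (N : ℕ) {s t : ℝ} (hs : 0 ≤ s) (hst : s ≤ t) : rho N t ≤ rho N s := by
  unfold rho
  apply Real.rpow_le_rpow_of_nonpos (by linarith) (by linarith)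
  have : (0:ℝ) ≤ N := Nat.cast_nonneg N
  linarith

lemma rho_deriv (N : ℕ) {s : ℝ} (hs : -1 < s) :
    HasDerivAt (rho N) (-((N:ℝ) / 2) * rho N s / (1 + s)) s := by
  have h1 : (0:ℝ) < 1 + s := by linarith
  have := ((hasDerivAt_id s).const_add 1).rpow_const (p := -((N:ℝ) / 2)) (Or.inl h1.ne')
  refine HasDerivAt.congr_deriv this ?_
  simp only [id, rho]
  rw [Real.rpow_sub_one h1.ne']
  ring

lemma rho_deriv2 (N : ℕ) {s : ℝ} (hs : -1 < s) :
    HasDerivAt (fun s => -((N:ℝ) / 2) * rho N s / (1 + s))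
      ((N:ℝ) / 2 * ((N:ℝ) / 2 + 1) * rho N s / (1 + s) ^ 2) s := by
  have h1 : (1:ℝ) + s ≠ 0 := by linarith
  have := ((rho_deriv N hs).const_mul (-((N:ℝ) / 2))).div ((hasDerivAt_id s).const_add 1) h1
  refine HasDerivAt.congr_deriv this ?_
  simp only [id]
  field_simp
  ring

lemma qq_pos (N : ℕ) {s : ℝ} (hs : 0 < s) : 0 < qq N s := by
  unfold qq; positivity

lemma qq_deriv (N : ℕ) {s : ℝ} (hs : 0 < s) :
    HasDerivAt (qq N) (qq N s * (-((N:ℝ) / 2 + 1) / s + N / (1 + s))) s := by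
  have h1 : (1:ℝ) + s ≠ 0 := by linarith
  have h2 := ((hasDerivAt_id s).rpow_const (p := -((N:ℝ) / 2) - 1) (Or.inl hs.ne')).mul
    (((hasDerivAt_id s).const_add 1).pow N)
  refine HasDerivAt.congr_deriv h2 ?_
  simp only [id, qq, Pi.pow_apply]
  rw [Real.rpow_sub_one hs.ne']
  rcases N with _ | n
  · simp
    field_simp
  · simp only [Nat.add_sub_cancel, pow_succ]
    field_simp
    ring

lemma qq_contOn (N : ℕ) : ContinuousOn (qq N) (Set.Ioi 0) := fun s hs =>
  (qq_deriv N hs).continuousAt.continuousWithinAt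

lemma qq_int (N : ℕ) {s t : ℝ} (hs : 0 < s) (ht : 0 < t) :
    IntervalIntegrable (qq N) MeasureTheory.volume s t := by
  apply ContinuousOn.intervalIntegrable
  apply (qq_contOn N).mono
  intro z hz
  rcases Set.mem_uIcc.1 hz with h | h
  · exact lt_of_lt_of_le hs h.1
  · exact lt_of_lt_of_le ht h.1

lemma BB_deriv (N : ℕ) {s0 s : ℝ} (h0 : 0 < s0) (hs : 0 < s) :
    HasDerivAt (BB N s0) (qq N s) s := by
  unfold BB
  apply intervalIntegral.integral_hasDerivAt_right (qq_int N h0 hs)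
  · exact (qq_contOn N).stronglyMeasurableAtFilter isOpen_Ioi s hs
  · exact (qq_deriv N hs).continuousAt

lemma BB_self (N : ℕ) (s0 : ℝ) : BB N s0 s0 = 0 := by simp [BB]

lemma BB_nonneg (N : ℕ) {s0 s : ℝ} (h0 : 0 < s0) (hs : s0 ≤ s) : 0 ≤ BB N s0 s := by
  apply intervalIntegral.integral_nonneg hs
  intro u hu
  exact (qq_pos N (lt_of_lt_of_le h0 hu.1)).le

lemma BB_lower (N : ℕ) (hN : 3 ≤ N) {s0 s : ℝ} (h0 : 0 < s0) (hs : s0 ≤ s) :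
    2 / N * (s ^ ((N:ℝ) / 2) - s0 ^ ((N:ℝ) / 2)) ≤ BB N s0 s := by
  have hN' : (3:ℝ) ≤ N := by exact_mod_cast hN
  have h1 : ∫ t in s0..s, t ^ ((N:ℝ) / 2 - 1) = 2 / N * (s ^ ((N:ℝ) / 2) - s0 ^ ((N:ℝ) / 2)) := by
    rw [integral_rpow (Or.inl (by linarith))]
    rw [sub_add_cancel]
    field_simp
  rw [← h1]
  apply intervalIntegral.integral_mono_on hs _ (qq_int N h0 (by linarith))
  · intro t ht
    have htp : 0 < t := lt_of_lt_of_le h0 ht.1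
    have e : t ^ ((N:ℝ) / 2 - 1) = t ^ (-((N:ℝ) / 2) - 1) * t ^ N := by
      rw [← Real.rpow_natCast, ← Real.rpow_add htp]; congr 1; ring
    rw [e]
    unfold qq
    gcongr
    linarith
  · apply intervalIntegral.intervalIntegrable_rpow'
    linarith

lemma KK_deriv (N : ℕ) (s : ℝ) : HasDerivAt (KK N) ((1 + s) ^ N) s := by
  have := (((hasDerivAt_id s).const_add 1).pow (N + 1)).div_const ((N:ℝ) + 1)
  refine HasDerivAt.congr_deriv this ?_
  have : (N:ℝ) + 1 ≠ 0 := by positivity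
  simp only [id, Nat.add_sub_cancel]
  push_cast
  field_simp

lemma KK_mono (N : ℕ) {s t : ℝ} (hs : 0 ≤ s) (hst : s ≤ t) : KK N s ≤ KK N t := by
  unfold KK; gcongr

lemma pow_deriv' (N : ℕ) {s : ℝ} (hs : 1 + s ≠ 0) :
    HasDerivAt (fun s : ℝ => (1 + s) ^ N) (N * (1 + s) ^ N / (1 + s)) s := by
  have := ((hasDerivAt_id s).const_add 1).pow N
  refine HasDerivAt.congr_deriv this ?_
  simp only [id]
  rcases N with _ | n
  · simp
  · simp only [Nat.add_sub_cancel, pow_succ]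
    field_simp

lemma barrier {N : ℕ} {a : EuclideanSpace ℝ (Fin N)} (ha : ‖a‖ = 1) {s0 : ℝ} (h0 : 0 < s0)
    (ε c η : ℝ) (x : EuclideanSpace ℝ (Fin N)) (hX : 0 < inner ℝ a x) :
    ∃ d : Fin N → ℝ, (∀ i, HS (fun y => inner ℝ a y * (rho N (‖y‖ ^ 2) *
        (ε * BB N s0 (‖y‖ ^ 2) + c - η * KK N (‖y‖ ^ 2)))
        - η * (inner ℝ a y * log (inner ℝ a y) * rho N (‖y‖ ^ 2))) x (EuclideanSpace.single i 1) (d i)) ∧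
      ∑ i, d i + (N:ℝ) * (N + 2) / (1 + ‖x‖ ^ 2) ^ 2 * (inner ℝ a x * (rho N (‖x‖ ^ 2) *
        (ε * BB N s0 (‖x‖ ^ 2) + c - η * KK N (‖x‖ ^ 2)))
        - η * (inner ℝ a x * log (inner ℝ a x) * rho N (‖x‖ ^ 2))) =
      -η * inner ℝ a x * rho N (‖x‖ ^ 2) * ((2 * N + 4) * (1 + ‖x‖ ^ 2) ^ N + 1 / (inner ℝ a x) ^ 2
        - 2 * N / (1 + ‖x‖ ^ 2)) := by
  have hxn : 0 < ‖x‖ := lt_of_lt_of_le hX (inner_le_norm' ha x)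
  have hsp : 0 < ‖x‖ ^ 2 := by positivity
  -- first product
  have hg : ∀ s : ℝ, 0 < s → HasDerivAt (fun s => rho N s * (ε * BB N s0 s + c - η * KK N s))
      (-((N:ℝ) / 2) * rho N s / (1 + s) * (ε * BB N s0 s + c - η * KK N s)
        + rho N s * (ε * qq N s - η * (1 + s) ^ N)) s := by
    intro s hs
    exact (rho_deriv N (by linarith)).mul
      ((((BB_deriv N h0 hs).const_mul ε).add_const c).sub ((KK_deriv N s).const_mul η))
  have hg2 : ∀ s : ℝ, 0 < s → HasDerivAt (fun s =>
      -((N:ℝ) / 2) * rho N s / (1 + s) * (ε * BB N s0 s + c - η * KK N s)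
        + rho N s * (ε * qq N s - η * (1 + s) ^ N))
      (((N:ℝ) / 2 * ((N:ℝ) / 2 + 1) * rho N s / (1 + s) ^ 2) * (ε * BB N s0 s + c - η * KK N s)
        + 2 * (-((N:ℝ) / 2) * rho N s / (1 + s)) * (ε * qq N s - η * (1 + s) ^ N)
        + rho N s * (ε * (qq N s * (-((N:ℝ) / 2 + 1) / s + N / (1 + s)))
            - η * (N * (1 + s) ^ N / (1 + s)))) s := by
    intro s hs
    have h1 : (1:ℝ) + s ≠ 0 := by linarith
    have := ((rho_deriv2 N (by linarith : -1 < s)).mul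
      ((((BB_deriv N h0 hs).const_mul ε).add_const c).sub ((KK_deriv N s).const_mul η))).add
      ((rho_deriv N (by linarith : -1 < s)).mul
        (((qq_deriv N hs).const_mul ε).sub ((pow_deriv' N h1).const_mul η)))
    refine HasDerivAt.congr_deriv this ?_
    simp only [Pi.sub_apply]
    ring
  have hlog : ∀ z : ℝ, 0 < z → HasDerivAt (fun z => z * log z) (log z + 1) z := by
    intro z hz
    have := (hasDerivAt_id z).mul (Real.hasDerivAt_log hz.ne')
    refine HasDerivAt.congr_deriv this ?_
    simp [hz.ne']
  refine ⟨_, fun i => (HS_prod a x i (fun z => z) (fun _ => 1)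
    (fun s => rho N s * (ε * BB N s0 s + c - η * KK N s)) _ 0 _
    (Eventually.of_forall fun z => hasDerivAt_id z) (hasDerivAt_const _ _)
    ((lt_mem_nhds hsp).mono fun s hs => hg s hs) (hg2 _ hsp)).sub
    ((HS_prod a x i (fun z => z * log z) (fun z => log z + 1) (rho N) _ _ _
      ((lt_mem_nhds hX).mono fun z hz => hlog z hz) ((Real.hasDerivAt_log hX.ne').add_const 1)
      ((lt_mem_nhds hsp).mono fun s hs => rho_deriv N (by linarith))
      (rho_deriv2 N (by linarith))).const_mul η), ?_⟩
  rw [Finset.sum_sub_distrib, ← Finset.mul_sum, sum_prod, sum_prod, ha]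
  generalize hX' : (inner ℝ a x : ℝ) = X at *
  generalize hs' : ‖x‖ ^ 2 = s at *
  have h1 : (1:ℝ) + s ≠ 0 := by linarith
  have h2 : s ≠ 0 := hsp.ne'
  have h3 : X ≠ 0 := hX.ne'
  generalize rho N s = r
  generalize BB N s0 s = b
  generalize KK N s = k
  generalize qq N s = q
  generalize log X = l
  generalize (1 + s) ^ N = P
  field_simp
  ring

lemma core1 {N : ℕ} {f : EuclideanSpace ℝ (Fin N) → ℝ} (hf : ContDiff ℝ 2 f)
    (hs : ∀ x, lap f x + (N:ℝ) * (N + 2) / (1 + ‖x‖ ^ 2) ^ 2 * f x = 0)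
    {a : EuclideanSpace ℝ (Fin N)} (ha : ‖a‖ = 1) {δ R μ ε η C : ℝ} (hδ : 0 < δ)
    (hε : 0 ≤ ε) (hη : 0 < η) (hμ : 0 ≤ μ)
    (h1 : ∀ y, ‖y‖ = δ → 0 < inner ℝ a y → f y ≤ μ * (inner ℝ a y * rho N (δ ^ 2)))
    (h2 : ∀ y, ‖y‖ = R → 0 < inner ℝ a y →
      f y ≤ ε * BB N (δ ^ 2) (R ^ 2) * (inner ℝ a y * rho N (R ^ 2)))
    (h3 : ∀ y, ‖y‖ ≤ R → 0 ≤ inner ℝ a y → |f y| ≤ C * inner ℝ a y)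
    (x : EuclideanSpace ℝ (Fin N)) (hx1 : δ ≤ ‖x‖) (hx2 : ‖x‖ ≤ R) (hX : 0 < inner ℝ a x) :
    f x / (inner ℝ a x * rho N (‖x‖ ^ 2)) ≤ μ + ε * BB N (δ ^ 2) (‖x‖ ^ 2)
      + η * (log R + KK N (R ^ 2) - log (inner ℝ a x) - KK N (‖x‖ ^ 2)) := by
  have hRpos : 0 < R := by linarith
  have hρR := rho_pos N (sq_nonneg R)
  have hC : 0 ≤ C := by
    have := (abs_nonneg _).trans (h3 x hx2 hX.le)
    exact nonneg_of_mul_nonneg_left this hX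
  set τ : ℝ := min (inner ℝ a x) (R * exp (-(C / (rho N (R ^ 2) * η)))) with hτ
  have hτpos : 0 < τ := lt_min hX (by positivity)
  have hlogτ : log τ ≤ log R - C / (rho N (R ^ 2) * η) := by
    have : log τ ≤ log (R * exp (-(C / (rho N (R ^ 2) * η)))) :=
      Real.log_le_log hτpos (min_le_right _ _)
    rw [Real.log_mul hRpos.ne' (exp_pos _).ne', Real.log_exp] at this
    linarith
  set G : EuclideanSpace ℝ (Fin N) → ℝ := fun y => f y / (inner ℝ a y * rho N (‖y‖ ^ 2))
    - ε * BB N (δ ^ 2) (‖y‖ ^ 2) + η * (log (inner ℝ a y) + KK N (‖y‖ ^ 2)) with hG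
  suffices hmain : G x ≤ μ + η * (log R + KK N (R ^ 2)) by
    simp only [hG] at hmain
    linarith
  have hci : Continuous (fun y : EuclideanSpace ℝ (Fin N) => (inner ℝ a y : ℝ)) := by fun_prop
  set K : Set (EuclideanSpace ℝ (Fin N)) :=
    Metric.closedBall 0 R ∩ ({y | δ ≤ ‖y‖} ∩ {y | τ ≤ inner ℝ a y}) with hKdef
  have hK : IsCompact K := (isCompact_closedBall 0 R).inter_right
    ((isClosed_le continuous_const continuous_norm).inter (isClosed_le continuous_const hci))
  have hGc : ContinuousOn G K := by
    rintro y ⟨-, -, hy⟩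
    have hy' : 0 < inner ℝ a y := lt_of_lt_of_le hτpos hy
    have hyn : 0 < ‖y‖ := lt_of_lt_of_le hy' (inner_le_norm' ha y)
    have hyn2 : 0 < ‖y‖ ^ 2 := by positivity
    apply ContinuousAt.continuousWithinAt
    have c1 : ContinuousAt (fun y : EuclideanSpace ℝ (Fin N) => ‖y‖ ^ 2) y := by fun_prop
    have c2 : ContinuousAt (fun y : EuclideanSpace ℝ (Fin N) => rho N (‖y‖ ^ 2)) y :=
      ContinuousAt.comp (g := rho N) (rho_deriv N (by linarith)).continuousAt c1
    have c3 : ContinuousAt (fun y : EuclideanSpace ℝ (Fin N) => BB N (δ ^ 2) (‖y‖ ^ 2)) y :=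
      ContinuousAt.comp (g := BB N (δ ^ 2)) (BB_deriv N (by positivity) hyn2).continuousAt c1
    have c4 : ContinuousAt (fun y : EuclideanSpace ℝ (Fin N) => KK N (‖y‖ ^ 2)) y :=
      ContinuousAt.comp (g := KK N) (KK_deriv N _).continuousAt c1
    have c5 := hci.continuousAt (x := y)
    exact ((hf.continuous.continuousAt.div (c5.mul c2)
      (mul_pos hy' (rho_pos N hyn2.le)).ne').sub (c3.const_mul ε)).add
      (((c5.log hy'.ne').add c4).const_mul η)
  have hxK : x ∈ K := ⟨by simpa using hx2, hx1, (show τ ≤ inner ℝ a x from min_le_left _ _)⟩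
  obtain ⟨y, hyK, hmax⟩ := hK.exists_isMaxOn ⟨x, hxK⟩ hGc
  refine (hmax hxK).trans ?_
  obtain ⟨hyR, hyδ, hyτ⟩ := hyK
  rw [Metric.mem_closedBall, dist_zero_right] at hyR
  change δ ≤ ‖y‖ at hyδ
  change τ ≤ inner ℝ a y at hyτ
  have hYpos : 0 < inner ℝ a y := lt_of_lt_of_le hτpos hyτ
  have hyn : 0 < ‖y‖ := lt_of_lt_of_le hYpos (inner_le_norm' ha y)
  have hρ : 0 < rho N (‖y‖ ^ 2) := rho_pos N (by positivity)
  have hz : 0 < inner ℝ a y * rho N (‖y‖ ^ 2) := mul_pos hYpos hρ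
  have hKm : KK N (‖y‖ ^ 2) ≤ KK N (R ^ 2) := KK_mono N (by positivity) (by gcongr)
  have hlogY : log (inner ℝ a y) ≤ log R :=
    Real.log_le_log hYpos ((inner_le_norm' ha y).trans hyR)
  have hsum : η * (log (inner ℝ a y) + KK N (‖y‖ ^ 2)) ≤ η * (log R + KK N (R ^ 2)) := by
    gcongr
  rcases hyδ.eq_or_lt with e | hyδ'
  · have : f y / (inner ℝ a y * rho N (‖y‖ ^ 2)) ≤ μ := by
      rw [div_le_iff₀ hz, ← e]; exact h1 y e.symm hYpos
    simp only [hG]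
    have e2 : BB N (δ ^ 2) (‖y‖ ^ 2) = 0 := by rw [← e, BB_self]
    rw [e2]
    linarith
  rcases hyR.eq_or_lt with e | hyR'
  · have : f y / (inner ℝ a y * rho N (‖y‖ ^ 2)) ≤ ε * BB N (δ ^ 2) (R ^ 2) := by
      rw [div_le_iff₀ hz, e]; exact h2 y e hYpos
    simp only [hG]
    have e2 : BB N (δ ^ 2) (‖y‖ ^ 2) = BB N (δ ^ 2) (R ^ 2) := by rw [e]
    rw [e2]
    linarith
  rcases hyτ.eq_or_lt with e | hyτ'
  · have hb : f y / (inner ℝ a y * rho N (‖y‖ ^ 2)) ≤ C / rho N (R ^ 2) := by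
      rw [div_le_div_iff₀ hz hρR]
      have i1 : f y ≤ C * inner ℝ a y := (le_abs_self _).trans (h3 y hyR hYpos.le)
      have i2 : rho N (R ^ 2) ≤ rho N (‖y‖ ^ 2) := rho_anti N (by positivity) (by gcongr)
      calc f y * rho N (R ^ 2) ≤ (C * inner ℝ a y) * rho N (R ^ 2) := by gcongr
        _ ≤ (C * inner ℝ a y) * rho N (‖y‖ ^ 2) := by gcongr
        _ = _ := by ring
    have hB : 0 ≤ ε * BB N (δ ^ 2) (‖y‖ ^ 2) :=
      mul_nonneg hε (BB_nonneg N (by positivity) (by gcongr))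
    have i3 : η * (log (inner ℝ a y) + KK N (‖y‖ ^ 2)) ≤
        η * (log R - C / (rho N (R ^ 2) * η) + KK N (R ^ 2)) := by
      rw [← e]; gcongr
    have i4 : η * (log R - C / (rho N (R ^ 2) * η) + KK N (R ^ 2)) =
        η * (log R + KK N (R ^ 2)) - C / rho N (R ^ 2) := by
      field_simp
      ring
    simp only [hG]
    linarith
  · exfalso
    have hn : K ∈ 𝓝 y := by
      refine Filter.inter_mem (Metric.closedBall_mem_nhds_of_mem (by simpa using hyR'))
        (Filter.inter_mem ?_ ?_)
      · exact (continuous_norm.continuousAt.eventually (lt_mem_nhds hyδ')).mono fun z hz => le_of_lt hz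
      · exact (hci.continuousAt.eventually (lt_mem_nhds hyτ')).mono fun z hz => le_of_lt hz
    obtain ⟨d, hd, hdsum⟩ := barrier ha (by positivity : 0 < δ ^ 2) ε (G y) η y hYpos
    have hU : ∀ z, 0 < inner ℝ a z → f z - (inner ℝ a z * (rho N (‖z‖ ^ 2) *
        (ε * BB N (δ ^ 2) (‖z‖ ^ 2) + G y - η * KK N (‖z‖ ^ 2)))
        - η * (inner ℝ a z * log (inner ℝ a z) * rho N (‖z‖ ^ 2))) =
        inner ℝ a z * rho N (‖z‖ ^ 2) * (G z - G y) := by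
      intro z hz
      have hr : rho N (‖z‖ ^ 2) ≠ 0 := (rho_pos N (by positivity)).ne'
      have hz' := hz.ne'
      generalize G y = c
      simp only [hG]
      field_simp
      ring
    have hloc : IsLocalMax (fun z => f z - (inner ℝ a z * (rho N (‖z‖ ^ 2) *
        (ε * BB N (δ ^ 2) (‖z‖ ^ 2) + G y - η * KK N (‖z‖ ^ 2)))
        - η * (inner ℝ a z * log (inner ℝ a z) * rho N (‖z‖ ^ 2)))) y := by
      filter_upwards [hn] with z hzK
      have hzp : 0 < inner ℝ a z := lt_of_lt_of_le hτpos hzK.2.2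
      rw [hU z hzp, hU y hYpos, sub_self, mul_zero]
      have := hmax hzK
      exact mul_nonpos_of_nonneg_of_nonpos (mul_pos hzp (rho_pos N (by positivity))).le
        (sub_nonpos.2 this)
    have hle : ∑ i, (fderiv ℝ (fderiv ℝ f) y (EuclideanSpace.single i 1) (EuclideanSpace.single i 1)
        - d i) ≤ 0 :=
      Finset.sum_nonpos fun i _ => ((HS_of_contDiff hf y _).sub (hd i)).nonpos hloc
    rw [Finset.sum_sub_distrib, ← lap_eq_sum hf y] at hle
    have hUy := hU y hYpos
    rw [sub_self, mul_zero, sub_eq_zero] at hUy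
    rw [← hUy] at hdsum
    have hlap := hs y
    have hneg : 0 < η * inner ℝ a y * rho N (‖y‖ ^ 2) * ((2 * N + 4) * (1 + ‖y‖ ^ 2) ^ N
        + 1 / (inner ℝ a y) ^ 2 - 2 * N / (1 + ‖y‖ ^ 2)) := by
      apply mul_pos (by positivity)
      have k1 : (1:ℝ) ≤ (1 + ‖y‖ ^ 2) ^ N := one_le_pow₀ (by nlinarith [sq_nonneg ‖y‖])
      have k2 : 2 * (N:ℝ) / (1 + ‖y‖ ^ 2) ≤ 2 * N := by
        apply div_le_self (by positivity); nlinarith [sq_nonneg ‖y‖]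
      have k3 : 0 < 1 / (inner ℝ a y) ^ 2 := by positivity
      have k4 : (2 * (N:ℝ) + 4) * 1 ≤ (2 * N + 4) * (1 + ‖y‖ ^ 2) ^ N := by gcongr
      linarith
    linarith

lemma core2 {N : ℕ} {f : EuclideanSpace ℝ (Fin N) → ℝ} (hf : ContDiff ℝ 2 f)
    (hs : ∀ x, lap f x + (N:ℝ) * (N + 2) / (1 + ‖x‖ ^ 2) ^ 2 * f x = 0)
    {a : EuclideanSpace ℝ (Fin N)} (ha : ‖a‖ = 1) {δ R μ ε C : ℝ} (hδ : 0 < δ)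
    (hε : 0 ≤ ε) (hμ : 0 ≤ μ)
    (h1 : ∀ y, ‖y‖ = δ → 0 < inner ℝ a y → f y ≤ μ * (inner ℝ a y * rho N (δ ^ 2)))
    (h2 : ∀ y, ‖y‖ = R → 0 < inner ℝ a y →
      f y ≤ ε * BB N (δ ^ 2) (R ^ 2) * (inner ℝ a y * rho N (R ^ 2)))
    (h3 : ∀ y, ‖y‖ ≤ R → 0 ≤ inner ℝ a y → |f y| ≤ C * inner ℝ a y)
    (x : EuclideanSpace ℝ (Fin N)) (hx1 : δ ≤ ‖x‖) (hx2 : ‖x‖ ≤ R) (hX : 0 < inner ℝ a x) :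
    f x / (inner ℝ a x * rho N (‖x‖ ^ 2)) ≤ μ + ε * BB N (δ ^ 2) (‖x‖ ^ 2) := by
  set h := f x / (inner ℝ a x * rho N (‖x‖ ^ 2))
  set b := μ + ε * BB N (δ ^ 2) (‖x‖ ^ 2)
  set D := log R + KK N (R ^ 2) - log (inner ℝ a x) - KK N (‖x‖ ^ 2)
  by_contra hc
  push Not at hc
  have key := core1 hf hs ha hδ hε (η := (h - b) / (2 * (|D| + 1)))
    (div_pos (by linarith) (by positivity)) hμ h1 h2 h3 x hx1 hx2 hX
  change h ≤ b + (h - b) / (2 * (|D| + 1)) * D at key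
  have : (h - b) / (2 * (|D| + 1)) * D ≤ (h - b) / 2 := by
    rw [div_mul_eq_mul_div, div_le_div_iff₀ (by positivity) (by norm_num)]
    have : D ≤ |D| + 1 := by linarith [le_abs_self D]
    nlinarith [mul_le_mul_of_nonneg_left this (by linarith : 0 ≤ h - b)]
  linarith

lemma core {N : ℕ} {f : EuclideanSpace ℝ (Fin N) → ℝ} (hN : 3 ≤ N) (hf : ContDiff ℝ 2 f)
    (hs : ∀ x, lap f x + (N:ℝ) * (N + 2) / (1 + ‖x‖ ^ 2) ^ 2 * f x = 0)
    {a : EuclideanSpace ℝ (Fin N)} (ha : ‖a‖ = 1) (h0 : ∀ x, inner ℝ a x = 0 → f x = 0)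
    {M : ℝ} (hM0 : 0 < M) (hM : ∀ x, |f x| ≤ M) (hd : fderiv ℝ f 0 a = 0)
    (x : EuclideanSpace ℝ (Fin N)) (hX : 0 < inner ℝ a x) : f x ≤ 0 := by
  have hN' : (3:ℝ) ≤ N := by exact_mod_cast hN
  have hxn : 0 < ‖x‖ := lt_of_lt_of_le hX (inner_le_norm' ha x)
  have hz : 0 < inner ℝ a x * rho N (‖x‖ ^ 2) := mul_pos hX (rho_pos N (by positivity))
  have hcd : Continuous (fun y => |fderiv ℝ f y a|) := by
    have : Continuous (fderiv ℝ f) := hf.continuous_fderiv (by norm_num)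
    fun_prop
  suffices hh : f x / (inner ℝ a x * rho N (‖x‖ ^ 2)) ≤ 0 by
    rwa [div_le_iff₀ hz, zero_mul] at hh
  apply le_of_forall_pos_le_add
  intro μ hμ
  rw [zero_add]
  have hρ1 := rho_pos N zero_le_one
  obtain ⟨δ0, hδ0, hδ⟩ : ∃ δ0 > 0, ∀ y : EuclideanSpace ℝ (Fin N), ‖y‖ < δ0 →
      |fderiv ℝ f y a| < μ * rho N 1 := by
    have h00 : |fderiv ℝ f 0 a| < μ * rho N 1 := by
      rw [hd, abs_zero]
      exact mul_pos hμ hρ1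
    have h1 := (hcd.tendsto 0).eventually (gt_mem_nhds h00)
    obtain ⟨δ0, h2, h3⟩ := Metric.eventually_nhds_iff.1 h1
    exact ⟨δ0, h2, fun y hy => h3 (by simpa using hy)⟩
  set δ := min (δ0 / 2) (min 1 (‖x‖ / 2)) with hδdef
  have hδp : 0 < δ := lt_min (by positivity) (lt_min one_pos (by positivity))
  have hδ1 : δ ≤ 1 := (min_le_right _ _).trans (min_le_left _ _)
  have hδx : δ ≤ ‖x‖ / 2 := (min_le_right _ _).trans (min_le_right _ _)
  have hδδ : δ < δ0 := lt_of_le_of_lt (min_le_left _ _) (by linarith)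
  have h1 : ∀ y, ‖y‖ = δ → 0 < inner ℝ a y → f y ≤ μ * (inner ℝ a y * rho N (δ ^ 2)) := by
    intro y hy hY
    have := flat_bound hf ha h0 (R := δ) (C := μ * rho N 1)
      (fun z hz => (hδ z (lt_of_le_of_lt hz hδδ)).le) y hy.le hY.le
    have hρ : rho N 1 ≤ rho N (δ ^ 2) := rho_anti N (by positivity) (by nlinarith)
    calc f y ≤ _ := (le_abs_self _).trans this
      _ = μ * (inner ℝ a y * rho N 1) := by ring
      _ ≤ _ := by gcongr
  -- constant
  set C1 : ℝ := 4 * (2 * N + 1) * M * 2 ^ ((N:ℝ) / 2) * N with hC1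
  have hC1p : 0 < C1 := by positivity
  set b := BB N (δ ^ 2) (‖x‖ ^ 2) with hb
  have hbn : 0 ≤ b := BB_nonneg N (by positivity) (by gcongr; linarith)
  have hkey : ∀ R : ℝ, (N:ℝ) + 2 ≤ R → ‖x‖ ≤ R →
      f x / (inner ℝ a x * rho N (‖x‖ ^ 2)) ≤ μ + C1 / R * b := by
    intro R hR hxR
    have hRp : 0 < R := by linarith
    obtain ⟨C, hC⟩ : ∃ C, ∀ y : EuclideanSpace ℝ (Fin N), ‖y‖ ≤ R → |fderiv ℝ f y a| ≤ C := by
      obtain ⟨C, hC⟩ := (isCompact_closedBall (0 : EuclideanSpace ℝ (Fin N)) R).bddAbove_image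
        hcd.continuousOn
      exact ⟨C, fun y hy => hC ⟨y, by simpa using hy, rfl⟩⟩
    refine core2 hf hs ha hδp (by positivity) hμ.le h1 ?_ (flat_bound hf ha h0 hC) x (by linarith)
      hxR hX
    intro y hy hY
    have i1 := infty_bound hN hf hs ha h0 hM0 hM y (by rw [hy]; exact hR) hY
    rw [hy] at i1
    refine i1.trans ?_
    have i2 : R ^ (N:ℝ) / N ≤ BB N (δ ^ 2) (R ^ 2) := by
      refine le_trans ?_ (BB_lower N hN (by positivity) (by gcongr; linarith))
      rw [← Real.rpow_natCast R 2, ← Real.rpow_mul hRp.le, ← Real.rpow_natCast δ 2,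
        ← Real.rpow_mul hδp.le]
      have e : ((2:ℕ):ℝ) * ((N:ℝ) / 2) = N := by push_cast; ring
      rw [e]
      have j1 : δ ^ (N:ℝ) ≤ 1 := Real.rpow_le_one hδp.le hδ1 (by positivity)
      have j2 : 2 ≤ R ^ (N:ℝ) := by
        calc (2:ℝ) ≤ R := by linarith
          _ = R ^ (1:ℝ) := (Real.rpow_one R).symm
          _ ≤ R ^ (N:ℝ) := Real.rpow_le_rpow_of_exponent_le (by linarith) (by linarith)
      rw [div_mul_eq_mul_div]
      gcongr
      linarith
    have i3 : 1 ≤ rho N (R ^ 2) * (2 ^ ((N:ℝ) / 2) * R ^ (N:ℝ)) := by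
      have e : (2:ℝ) ^ ((N:ℝ) / 2) * R ^ (N:ℝ) = (2 * R ^ 2) ^ ((N:ℝ) / 2) := by
        rw [Real.mul_rpow (by norm_num) (by positivity), ← Real.rpow_natCast R 2,
          ← Real.rpow_mul hRp.le]
        congr 2; push_cast; ring
      rw [e, rho, Real.rpow_neg (by positivity), inv_mul_eq_div, one_le_div (by positivity)]
      apply Real.rpow_le_rpow (by positivity) _ (by positivity)
      nlinarith
    have hρR := rho_pos N (sq_nonneg R)
    calc 4 * (2 * N + 1) * M * inner ℝ a y / R
        = 4 * (2 * N + 1) * M * inner ℝ a y / R * 1 := by ring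
      _ ≤ 4 * (2 * N + 1) * M * inner ℝ a y / R * (rho N (R ^ 2) * (2 ^ ((N:ℝ) / 2) * R ^ (N:ℝ))) := by
          gcongr
      _ = C1 / R * (R ^ (N:ℝ) / N) * (inner ℝ a y * rho N (R ^ 2)) := by
          rw [hC1]; field_simp
      _ ≤ _ := by gcongr
  -- let R → ∞
  have hlim : Tendsto (fun R : ℝ => μ + C1 / R * b) atTop (𝓝 (μ + 0 * b)) :=
    ((tendsto_const_nhds.div_atTop tendsto_id).mul_const b).const_add μ
  rw [zero_mul, add_zero] at hlim
  refine ge_of_tendsto hlim ?_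
  filter_upwards [eventually_ge_atTop ((N:ℝ) + 2), eventually_ge_atTop ‖x‖] with R h1 h2
    using hkey R h1 h2

lemma pot_eq {N : ℕ} (hN : 3 ≤ N) (ξ : EuclideanSpace ℝ (Fin N)) :
    ((N : ℝ) + 2) / ((N : ℝ) - 2) * bubble N ξ ^ (((N : ℝ) + 2) / ((N : ℝ) - 2) - 1) =
      (N:ℝ) * (N + 2) / (1 + ‖ξ‖ ^ 2) ^ 2 := by
  have hN' : (3:ℝ) ≤ N := by exact_mod_cast hN
  have h2 : (0:ℝ) < (N:ℝ) - 2 := by linarith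
  have hn : (0:ℝ) < N := by linarith
  have hs : (0:ℝ) < 1 + ‖ξ‖ ^ 2 := by positivity
  have hb : (0:ℝ) < (N:ℝ) * ((N:ℝ) - 2) := by positivity
  unfold bubble
  rw [Real.mul_rpow (by positivity) (by positivity), ← Real.rpow_mul hb.le, ← Real.rpow_mul hs.le]
  have e1 : ((N:ℝ) - 2) / 4 * (((N : ℝ) + 2) / ((N : ℝ) - 2) - 1) = 1 := by
    field_simp; ring
  have e2 : -(((N:ℝ) - 2) / 2) * (((N : ℝ) + 2) / ((N : ℝ) - 2) - 1) = -(2:ℕ) := by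
    push_cast; field_simp; ring
  rw [e1, e2, Real.rpow_one, Real.rpow_neg hs.le, Real.rpow_natCast]
  field_simp

lemma rho_contDiff (N : ℕ) :
    ContDiff ℝ 2 (fun y : EuclideanSpace ℝ (Fin N) => rho N (‖y‖ ^ 2)) := by
  unfold rho
  refine ContDiff.rpow_const_of_ne (contDiff_const.add (contDiff_norm_sq ℝ)) fun x => ?_
  positivity

lemma lap_sub {N : ℕ} {f g : EuclideanSpace ℝ (Fin N) → ℝ} (hf : ContDiff ℝ 2 f)
    (hg : ContDiff ℝ 2 g) (x : EuclideanSpace ℝ (Fin N)) :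
    lap (fun y => f y - g y) x = lap f x - lap g x := by
  rw [lap_eq_of_HS (hf.sub hg) x
    (fun i => (HS_of_contDiff hf x _).sub (HS_of_contDiff hg x (EuclideanSpace.single i 1))),
    Finset.sum_sub_distrib, ← lap_eq_sum hf, ← lap_eq_sum hg]

lemma lap_cmul {N : ℕ} {f : EuclideanSpace ℝ (Fin N) → ℝ} (hf : ContDiff ℝ 2 f)
    (c : ℝ) (x : EuclideanSpace ℝ (Fin N)) :
    lap (fun y => c * f y) x = c * lap f x := by
  rw [lap_eq_of_HS (contDiff_const.mul hf) x
    (fun i => (HS_of_contDiff hf x (EuclideanSpace.single i 1)).const_mul c),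
    ← Finset.mul_sum, ← lap_eq_sum hf]

lemma lin_contDiff {N : ℕ} (a : EuclideanSpace ℝ (Fin N)) :
    ContDiff ℝ 2 (fun y : EuclideanSpace ℝ (Fin N) => inner ℝ a y * rho N (‖y‖ ^ 2)) :=
  (contDiff_const.inner ℝ contDiff_id).mul (rho_contDiff N)

lemma zeta_contDiff (N : ℕ) :
    ContDiff ℝ 2 (fun y : EuclideanSpace ℝ (Fin N) => (1 - ‖y‖ ^ 2) * rho N (‖y‖ ^ 2)) :=
  (contDiff_const.sub (contDiff_norm_sq ℝ)).mul (rho_contDiff N)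

lemma lin_sol {N : ℕ} (a x : EuclideanSpace ℝ (Fin N)) :
    lap (fun y : EuclideanSpace ℝ (Fin N) => inner ℝ a y * rho N (‖y‖ ^ 2)) x +
      (N:ℝ) * (N + 2) / (1 + ‖x‖ ^ 2) ^ 2 * (inner ℝ a x * rho N (‖x‖ ^ 2)) = 0 := by
  have hs : -1 < ‖x‖ ^ 2 := by nlinarith [sq_nonneg ‖x‖]
  have h := lap_eq_of_HS (lin_contDiff a) x (fun i => HS_prod a x i (fun t => t) (fun _ => 1)
    (rho N) _ 0 _ (Eventually.of_forall fun y => hasDerivAt_id y) (hasDerivAt_const _ _)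
    ((lt_mem_nhds hs).mono fun s h => rho_deriv N h) (rho_deriv2 N hs))
  rw [h, sum_prod]
  have : (0:ℝ) < 1 + ‖x‖ ^ 2 := by positivity
  field_simp
  ring

lemma zeta_sol {N : ℕ} (x : EuclideanSpace ℝ (Fin N)) :
    lap (fun y : EuclideanSpace ℝ (Fin N) => (1 - ‖y‖ ^ 2) * rho N (‖y‖ ^ 2)) x +
      (N:ℝ) * (N + 2) / (1 + ‖x‖ ^ 2) ^ 2 * ((1 - ‖x‖ ^ 2) * rho N (‖x‖ ^ 2)) = 0 := by
  have hs : -1 < ‖x‖ ^ 2 := by nlinarith [sq_nonneg ‖x‖]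
  have hg : ∀ s : ℝ, -1 < s → HasDerivAt (fun s => (1 - s) * rho N s)
      (-rho N s + (1 - s) * (-((N:ℝ) / 2) * rho N s / (1 + s))) s := by
    intro s hs
    refine HasDerivAt.congr_deriv (((hasDerivAt_id s).const_sub 1).mul (rho_deriv N hs)) ?_
    simp
  have hg2 : ∀ s : ℝ, -1 < s → HasDerivAt (fun s => -rho N s + (1 - s) * (-((N:ℝ) / 2) * rho N s / (1 + s)))
      (-2 * (-((N:ℝ) / 2) * rho N s / (1 + s)) + (1 - s) *
        ((N:ℝ) / 2 * ((N:ℝ) / 2 + 1) * rho N s / (1 + s) ^ 2)) s := by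
    intro s hs
    refine HasDerivAt.congr_deriv ((rho_deriv N hs).neg.add
      (((hasDerivAt_id s).const_sub 1).mul (rho_deriv2 N hs))) ?_
    simp
    ring
  have h := lap_eq_of_HS (u := fun y : EuclideanSpace ℝ (Fin N) => 1 * ((1 - ‖y‖ ^ 2) * rho N (‖y‖ ^ 2)))
    (contDiff_const.mul (zeta_contDiff N)) x
    (fun i => HS_prod 0 x i (fun _ => 1) (fun _ => 0)
    (fun s => (1 - s) * rho N s) _ 0 _ (Eventually.of_forall fun y => hasDerivAt_const _ _)
    (hasDerivAt_const _ _)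
    ((lt_mem_nhds hs).mono fun s h => hg s h) (hg2 _ hs))
  simp only [one_mul] at h
  rw [h]
  have h3 := sum_prod (0 : EuclideanSpace ℝ (Fin N)) x 0 0 
    (-rho N (‖x‖^2) + (1 - ‖x‖^2) * (-((N:ℝ) / 2) * rho N (‖x‖^2) / (1 + ‖x‖^2))) 1
    (-2 * (-((N:ℝ) / 2) * rho N (‖x‖^2) / (1 + ‖x‖^2)) + (1 - ‖x‖^2) *
        ((N:ℝ) / 2 * ((N:ℝ) / 2 + 1) * rho N (‖x‖^2) / (1 + ‖x‖^2) ^ 2))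
  have : (0:ℝ) < 1 + ‖x‖ ^ 2 := by positivity
  simp only [zero_mul, mul_zero, zero_add, one_mul] at h3 ⊢
  rw [h3]
  field_simp
  ring

lemma lin_bdd {N : ℕ} (hN : 3 ≤ N) (a x : EuclideanSpace ℝ (Fin N)) :
    |inner ℝ a x * rho N (‖x‖ ^ 2)| ≤ ‖a‖ := by
  have hN' : (3:ℝ) ≤ N := by exact_mod_cast hN
  have hρ := rho_pos N (sq_nonneg ‖x‖)
  have h1 : rho N (‖x‖ ^ 2) ≤ (1 + ‖x‖ ^ 2)⁻¹ := by
    rw [← Real.rpow_neg_one]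
    unfold rho
    apply Real.rpow_le_rpow_of_exponent_le
    · nlinarith [sq_nonneg ‖x‖]
    · linarith
  rw [abs_mul, abs_of_pos hρ]
  have h2 : ‖x‖ * (1 + ‖x‖ ^ 2)⁻¹ ≤ 1 := by
    rw [← div_eq_mul_inv, div_le_one (by positivity)]
    nlinarith [sq_nonneg (‖x‖ - 1), norm_nonneg x]
  calc |inner ℝ a x| * rho N (‖x‖ ^ 2) ≤ (‖a‖ * ‖x‖) * (1 + ‖x‖ ^ 2)⁻¹ := by
        gcongr
        exact abs_real_inner_le_norm a x
    _ = ‖a‖ * (‖x‖ * (1 + ‖x‖ ^ 2)⁻¹) := by ring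
    _ ≤ ‖a‖ * 1 := by gcongr
    _ = ‖a‖ := mul_one _

lemma lin_fderiv {N : ℕ} (a : EuclideanSpace ℝ (Fin N)) :
    HasFDerivAt (fun y : EuclideanSpace ℝ (Fin N) => inner ℝ a y * rho N (‖y‖ ^ 2))
      (innerSL ℝ a) 0 := by
  have h1 : HasFDerivAt (fun y : EuclideanSpace ℝ (Fin N) => innerSL ℝ a y) (innerSL ℝ a) 0 :=
    (innerSL ℝ a).hasFDerivAt
  have h2 := (((rho_contDiff N).differentiable (by norm_num)) 0).hasFDerivAt
  have h3 := h1.mul h2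
  refine HasFDerivAt.congr_fderiv h3 ?_
  ext v
  simp [rho]

lemma refl_eq {N : ℕ} {f : EuclideanSpace ℝ (Fin N) → ℝ} (hN : 3 ≤ N) (hf : ContDiff ℝ 2 f)
    (hs : ∀ x, lap f x + (N:ℝ) * (N + 2) / (1 + ‖x‖ ^ 2) ^ 2 * f x = 0)
    {M : ℝ} (hM : ∀ x, |f x| ≤ M) (hd : fderiv ℝ f 0 = 0)
    (x y : EuclideanSpace ℝ (Fin N)) (hxy : ‖x‖ = ‖y‖) : f x ≤ f y := by
  by_cases hne : x = y
  · rw [hne]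
  have hn : 0 < ‖x - y‖ := norm_pos_iff.2 (sub_ne_zero.2 hne)
  set σ : EuclideanSpace ℝ (Fin N) ≃ₗᵢ[ℝ] EuclideanSpace ℝ (Fin N) :=
    Submodule.reflection (Submodule.span ℝ {x - y})ᗮ with hσ
  have hσx : σ x = y := Submodule.reflection_sub hxy
  have hfσ : ContDiff ℝ 2 (fun z => f (σ z)) := hf.comp σ.contDiff
  have hMn : 0 ≤ M := (abs_nonneg _).trans (hM 0)
  have hinn : 0 < inner ℝ (x - y) x := by
    have := norm_sub_sq_real x y
    rw [inner_sub_left, real_inner_self_eq_norm_sq, real_inner_comm]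
    have h2 : 0 < ‖x - y‖ ^ 2 := by positivity
    rw [← hxy] at this
    nlinarith
  have key := core (f := fun z => f z - f (σ z)) (a := (‖x - y‖)⁻¹ • (x - y)) (M := 2 * M + 1) hN
    (hf.sub hfσ) ?_ ?_ ?_ (by linarith) ?_ ?_ x ?_
  · simp only [hσx] at key
    linarith
  · intro z
    rw [lap_sub hf hfσ, lap_comp hf σ]
    have h1 := hs z
    have h2 := hs (σ z)
    rw [LinearIsometryEquiv.norm_map] at h2
    linear_combination h1 - h2
  · rw [norm_smul, norm_inv, norm_norm, inv_mul_cancel₀ hn.ne']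
  · intro z hz
    rw [real_inner_smul_left] at hz
    have hz' : inner ℝ (x - y) z = 0 := by
      rcases mul_eq_zero.1 hz with h | h
      · exact absurd h (inv_ne_zero hn.ne')
      · exact h
    have : σ z = z := Submodule.reflection_mem_subspace_eq_self
      (Submodule.mem_orthogonal_singleton_iff_inner_right.2 hz')
    simp only [this, sub_self]
  · intro z
    have h1 := abs_le.1 (hM z)
    have h2 := abs_le.1 (hM (σ z))
    rw [abs_le]
    constructor <;> linarith
  · have h1 : HasFDerivAt f (0 : EuclideanSpace ℝ (Fin N) →L[ℝ] ℝ) (0 : EuclideanSpace ℝ (Fin N)) := by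
      rw [← hd]; exact ((hf.differentiable (by norm_num)) 0).hasFDerivAt
    have h1' : HasFDerivAt f (0 : EuclideanSpace ℝ (Fin N) →L[ℝ] ℝ) (σ 0) := by rw [map_zero]; exact h1
    have h2 := h1'.comp (0 : EuclideanSpace ℝ (Fin N)) (σ.toContinuousLinearEquiv.hasFDerivAt)
    have h3 := h1.sub h2
    have h4 : fderiv ℝ (fun z => f z - f (σ z)) 0 = _ := h3.fderiv
    rw [h4]
    simp
  · rw [real_inner_smul_left]
    positivity

lemma radial_zero {N : ℕ} {u : EuclideanSpace ℝ (Fin N) → ℝ} (hN : 3 ≤ N) (hu : ContDiff ℝ 2 u)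
    (hs : ∀ x, lap u x + (N:ℝ) * (N + 2) / (1 + ‖x‖ ^ 2) ^ 2 * u x = 0)
    (hr : ∀ x y, ‖x‖ = ‖y‖ → u x = u y) (h0 : u 0 = 0)
    (x : EuclideanSpace ℝ (Fin N)) : u x = 0 := by
  have hN' : (3:ℝ) ≤ N := by exact_mod_cast hN
  let i0 : Fin N := ⟨0, by omega⟩
  set e : EuclideanSpace ℝ (Fin N) := EuclideanSpace.single i0 1 with he
  have hen : ‖e‖ = 1 := by simp [he]
  have hd : Differentiable ℝ u := hu.differentiable (by norm_num)
  have hd2 : Differentiable ℝ (fderiv ℝ u) :=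
    (hu.fderiv_right (m := 1) (by norm_num)).differentiable (by norm_num)
  have hl : ∀ t : ℝ, HasDerivAt (fun t : ℝ => t • e) e t := by
    intro t
    refine HasDerivAt.congr_deriv ((hasDerivAt_id t).smul_const e) ?_
    simp
  set v : ℝ → ℝ := fun t => u (t • e) with hv
  set v1 : ℝ → ℝ := fun t => fderiv ℝ u (t • e) e with hv1
  set v2 : ℝ → ℝ := fun t => fderiv ℝ (fderiv ℝ u) (t • e) e e with hv2
  have dv : ∀ t, HasDerivAt v (v1 t) t := fun t => (hd (t • e)).hasFDerivAt.comp_hasDerivAt t (hl t)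
  have dv1 : ∀ t, HasDerivAt v1 (v2 t) t := by
    intro t
    have h := (hd2 (t • e)).hasFDerivAt.comp_hasDerivAt t (hl t)
    refine HasDerivAt.congr_deriv (h.clm_apply (hasDerivAt_const t e)) ?_
    simp [hv2]
  have hux : ∀ y, u y = v ‖y‖ := fun y => hr _ _ (by rw [norm_smul, hen]; simp)
  have hv10 : v1 0 = 0 := by
    have h1 := dv 0
    have h2 : HasDerivAt (fun t => v (-t)) (-(v1 0)) 0 := by
      have h3 : HasDerivAt v (v1 0) (-0) := by rw [neg_zero]; exact h1
      refine HasDerivAt.congr_deriv (h3.comp (0:ℝ) (hasDerivAt_neg (0:ℝ))) ?_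
      ring
    have h3 : (fun t => v (-t)) = v := by
      funext t
      exact hr _ _ (by simp)
    rw [h3] at h2
    have := h1.unique h2
    linarith
  have hode : ∀ t, 0 < t → v2 t + (N - 1) * (v1 t / t) +
      (N:ℝ) * (N + 2) / (1 + t ^ 2) ^ 2 * v t = 0 := by
    intro t ht
    have hHS : ∀ i : Fin N, HS u (t • e) (EuclideanSpace.single i 1)
        (if i = i0 then v2 t else v1 t / t) := by
      intro i
      split_ifs with hi
      · rw [hi]; exact HS_of_contDiff hu (t • e) e
      · have hp : ∀ τ : ℝ, 0 < t ^ 2 + τ ^ 2 := fun τ => by positivity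
        have hnorm : ∀ τ : ℝ, u (t • e + τ • EuclideanSpace.single i 1) = v (√(t ^ 2 + τ ^ 2)) := by
          intro τ
          rw [hux]
          congr 1
          rw [eq_comm, Real.sqrt_eq_iff_mul_self_eq (hp τ).le (norm_nonneg _), ← sq, line_norm, norm_smul, hen]
          have : (t • e) i = 0 := by simp [he, hi]
          rw [this]
          simp
        have hsq : ∀ τ : ℝ, HasDerivAt (fun τ : ℝ => √(t ^ 2 + τ ^ 2)) (τ / √(t ^ 2 + τ ^ 2)) τ := by
          intro τ
          have h1 : HasDerivAt (fun τ : ℝ => t ^ 2 + τ ^ 2) (2 * τ) τ := by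
            refine HasDerivAt.congr_deriv (((hasDerivAt_id τ).pow 2).const_add (t ^ 2)) ?_
            simp
          refine HasDerivAt.congr_deriv (h1.sqrt (hp τ).ne') ?_
          field_simp
        have hs0 : √(t ^ 2 + 0 ^ 2) = t := by
          rw [zero_pow (by norm_num), add_zero, Real.sqrt_sq ht.le]
        refine ⟨fun τ => v1 (√(t ^ 2 + τ ^ 2)) * (τ / √(t ^ 2 + τ ^ 2)), ?_, ?_⟩
        · refine Eventually.of_forall fun τ => ?_
          simp only [hnorm]
          exact (dv _).comp τ (hsq τ)
        · have h1 := (dv1 (√(t ^ 2 + 0 ^ 2))).comp (0:ℝ) (hsq 0)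
          have h2 := (hasDerivAt_id (0:ℝ)).div (hsq 0) (by rw [hs0]; exact ht.ne')
          refine HasDerivAt.congr_deriv (h1.mul h2) ?_
          simp only [Function.comp, id, hs0]
          simp
          field_simp
    have hlap := lap_eq_of_HS hu (t • e) hHS
    have hsum : ∑ i : Fin N, (if i = i0 then v2 t else v1 t / t) = v2 t + (N - 1) * (v1 t / t) := by
      have : ∀ i : Fin N, (if i = i0 then v2 t else v1 t / t) =
          v1 t / t + (if i = i0 then v2 t - v1 t / t else 0) := by
        intro i; split_ifs <;> ring
      simp only [this, Finset.sum_add_distrib, Finset.sum_ite_eq', Finset.mem_univ, if_true,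
        Finset.sum_const, Finset.card_univ, Fintype.card_fin, nsmul_eq_mul]
      ring
    have h1 := hs (t • e)
    rw [hlap, hsum, norm_smul, hen] at h1
    simpa using h1
  set E : ℝ → ℝ := fun t => v1 t ^ 2 + (N:ℝ) * (N + 2) / (1 + t ^ 2) ^ 2 * v t ^ 2 with hE
  have dE : ∀ t, HasDerivAt E (2 * v1 t * v2 t + (-(4 * t * ((N:ℝ) * (N + 2)) / (1 + t ^ 2) ^ 3) * v t ^ 2
      + (N:ℝ) * (N + 2) / (1 + t ^ 2) ^ 2 * (2 * v t * v1 t))) t := by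
    intro t
    have hp : (0:ℝ) < 1 + t ^ 2 := by positivity
    have h1 : HasDerivAt (fun t : ℝ => (1 + t ^ 2) ^ 2) (2 * (1 + t ^ 2) * (2 * t)) t := by
      refine HasDerivAt.congr_deriv ((((hasDerivAt_id t).pow 2).const_add 1).pow 2) ?_
      simp
    have h2 := (hasDerivAt_const t ((N:ℝ) * (N + 2))).div h1 (by positivity)
    refine HasDerivAt.congr_deriv (((dv1 t).pow 2).add (h2.mul ((dv t).pow 2))) ?_
    simp
    field_simp
    ring
  have hanti : AntitoneOn E (Set.Ici 0) := by
    apply antitoneOn_of_deriv_nonpos (convex_Ici 0)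
    · exact fun t _ => (dE t).continuousAt.continuousWithinAt
    · exact fun t _ => (dE t).differentiableAt.differentiableWithinAt
    · intro t ht
      rw [interior_Ici] at ht
      have ht : 0 < t := ht
      rw [(dE t).deriv]
      have h := hode t ht
      have h1 : 0 ≤ (N - 1) * (v1 t ^ 2 / t) := mul_nonneg (by linarith) (by positivity)
      have h2 : 0 ≤ 4 * t * ((N:ℝ) * (N + 2)) / (1 + t ^ 2) ^ 3 * v t ^ 2 := by positivity
      have h3 : v2 t = -((N - 1) * (v1 t / t)) - (N:ℝ) * (N + 2) / (1 + t ^ 2) ^ 2 * v t := by linarith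
      have h4 : 2 * v1 t * v2 t + (-(4 * t * ((N:ℝ) * (N + 2)) / (1 + t ^ 2) ^ 3) * v t ^ 2
          + (N:ℝ) * (N + 2) / (1 + t ^ 2) ^ 2 * (2 * v t * v1 t)) =
          -2 * ((N - 1) * (v1 t ^ 2 / t)) - 4 * t * ((N:ℝ) * (N + 2)) / (1 + t ^ 2) ^ 3 * v t ^ 2 := by
        rw [h3]; ring
      rw [h4]; linarith
  have hE0 : E 0 = 0 := by
    have : v 0 = 0 := by simp [hv, h0]
    simp [hE, this, hv10]
  have hle : E ‖x‖ ≤ 0 := by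
    rw [← hE0]
    exact hanti (Set.mem_Ici.2 le_rfl) (Set.mem_Ici.2 (norm_nonneg x)) (norm_nonneg x)
  rw [hux]
  have hW : 0 < (N:ℝ) * (N + 2) / (1 + ‖x‖ ^ 2) ^ 2 := by positivity
  have h5 : (N:ℝ) * (N + 2) / (1 + ‖x‖ ^ 2) ^ 2 * v ‖x‖ ^ 2 ≤ 0 := by
    have := sq_nonneg (v1 ‖x‖)
    have h6 : v1 ‖x‖ ^ 2 + (N:ℝ) * (N + 2) / (1 + ‖x‖ ^ 2) ^ 2 * v ‖x‖ ^ 2 ≤ 0 := hle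
    linarith
  have h7 : v ‖x‖ ^ 2 ≤ 0 := by
    by_contra hc
    push Not at hc
    have := mul_pos hW hc
    linarith
  exact pow_eq_zero_iff (two_ne_zero) |>.1 (le_antisymm h7 (sq_nonneg _))

lemma bubble_fderiv {N : ℕ} (ξ h : EuclideanSpace ℝ (Fin N)) :
    fderiv ℝ (bubble N) ξ h =
      -(((N : ℝ) * ((N : ℝ) - 2)) ^ (((N : ℝ) - 2) / 4) * ((N:ℝ) - 2)) * rho N (‖ξ‖ ^ 2) * inner ℝ ξ h := by
  have hp : (0:ℝ) < 1 + ‖ξ‖ ^ 2 := by positivity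
  have h1 : HasDerivAt (fun s : ℝ => ((N : ℝ) * ((N : ℝ) - 2)) ^ (((N : ℝ) - 2) / 4) *
      (1 + s) ^ (-(((N : ℝ) - 2) / 2)))
      (((N : ℝ) * ((N : ℝ) - 2)) ^ (((N : ℝ) - 2) / 4) * (-(((N : ℝ) - 2) / 2) * rho N (‖ξ‖ ^ 2))) (‖ξ‖ ^ 2) := by
    have := (((hasDerivAt_id (‖ξ‖ ^ 2)).const_add 1).rpow_const (p := -(((N : ℝ) - 2) / 2))
      (Or.inl hp.ne')).const_mul (((N : ℝ) * ((N : ℝ) - 2)) ^ (((N : ℝ) - 2) / 4))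
    refine HasDerivAt.congr_deriv this ?_
    simp only [id, rho]
    rw [show -(((N : ℝ) - 2) / 2) - 1 = -((N:ℝ) / 2) by ring]
    ring
  have h2 := h1.comp_hasFDerivAt ξ (hasStrictFDerivAt_norm_sq ξ).hasFDerivAt
  have h3 : fderiv ℝ (bubble N) ξ = _ := h2.fderiv
  rw [h3]
  simp
  ring

lemma bubble_rho {N : ℕ} (ξ : EuclideanSpace ℝ (Fin N)) :
    bubble N ξ = ((N : ℝ) * ((N : ℝ) - 2)) ^ (((N : ℝ) - 2) / 4) * ((1 + ‖ξ‖ ^ 2) * rho N (‖ξ‖ ^ 2)) := by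
  have hp : (0:ℝ) < 1 + ‖ξ‖ ^ 2 := by positivity
  unfold bubble rho
  rw [show -(((N : ℝ) - 2) / 2) = 1 + -((N:ℝ) / 2) by ring, Real.rpow_add hp, Real.rpow_one]


theorem statement3 (N : ℕ) (hN : 3 ≤ N) (φ : EuclideanSpace ℝ (Fin N) → ℝ)
    (hbdd : ∃ M : ℝ, ∀ ξ, |φ ξ| ≤ M) (hC2 : ContDiff ℝ 2 φ)
    (heq : ∀ ξ, lap φ ξ +
      ((N : ℝ) + 2) / ((N : ℝ) - 2) *
        bubble N ξ ^ (((N : ℝ) + 2) / ((N : ℝ) - 2) - 1) * φ ξ = 0) :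
    ∃ (c₀ : ℝ) (c : Fin N → ℝ), ∀ ξ,
      φ ξ = c₀ * Z0 N ξ + ∑ j : Fin N, c j * Zj N j ξ := by

  have hN' : (3:ℝ) ≤ N := by exact_mod_cast hN
  obtain ⟨M, hM⟩ := hbdd
  have hs : ∀ x, lap φ x + (N:ℝ) * (N + 2) / (1 + ‖x‖ ^ 2) ^ 2 * φ x = 0 := by
    intro x
    have := heq x
    rwa [pot_eq hN x] at this
  set g : EuclideanSpace ℝ (Fin N) :=
    (InnerProductSpace.toDual ℝ (EuclideanSpace ℝ (Fin N))).symm (fderiv ℝ φ 0) with hg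
  have hψC : ContDiff ℝ 2 (fun y : EuclideanSpace ℝ (Fin N) => φ y - inner ℝ g y * rho N (‖y‖ ^ 2)) :=
    hC2.sub (lin_contDiff g)
  have hψs : ∀ x, lap (fun y : EuclideanSpace ℝ (Fin N) => φ y - inner ℝ g y * rho N (‖y‖ ^ 2)) x +
      (N:ℝ) * (N + 2) / (1 + ‖x‖ ^ 2) ^ 2 * (φ x - inner ℝ g x * rho N (‖x‖ ^ 2)) = 0 := by
    intro x
    rw [lap_sub hC2 (lin_contDiff g)]
    linear_combination hs x - lin_sol g x
  have hψM : ∀ x : EuclideanSpace ℝ (Fin N), |φ x - inner ℝ g x * rho N (‖x‖ ^ 2)| ≤ M + ‖g‖ := fun x =>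
    (abs_sub _ _).trans (add_le_add (hM x) (lin_bdd hN g x))
  have hψd : fderiv ℝ (fun y : EuclideanSpace ℝ (Fin N) => φ y - inner ℝ g y * rho N (‖y‖ ^ 2)) 0 = 0 := by
    have h1 : fderiv ℝ (fun y : EuclideanSpace ℝ (Fin N) => φ y - inner ℝ g y * rho N (‖y‖ ^ 2)) 0 = _ :=
      (((hC2.differentiable (by norm_num)) 0).hasFDerivAt.sub (lin_fderiv g)).fderiv
    rw [h1]
    ext v
    simp [hg]
  have hrad : ∀ x y : EuclideanSpace ℝ (Fin N), ‖x‖ = ‖y‖ →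
      φ x - inner ℝ g x * rho N (‖x‖ ^ 2) = φ y - inner ℝ g y * rho N (‖y‖ ^ 2) := fun x y h =>
    le_antisymm (refl_eq hN hψC hψs hψM hψd x y h) (refl_eq hN hψC hψs hψM hψd y x h.symm)
  have hcz : ContDiff ℝ 2 (fun y : EuclideanSpace ℝ (Fin N) => φ 0 * ((1 - ‖y‖ ^ 2) * rho N (‖y‖ ^ 2))) :=
    contDiff_const.mul (zeta_contDiff N)
  have hzero := radial_zero hN (hψC.sub hcz) (fun x => by
      rw [lap_sub hψC hcz, lap_cmul (zeta_contDiff N)]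
      linear_combination hψs x - φ 0 * zeta_sol x)
    (fun x y h => by rw [hrad x y h, h]) (by simp [rho])
  set α : ℝ := ((N : ℝ) * ((N : ℝ) - 2)) ^ (((N : ℝ) - 2) / 4) with hα
  have hN2 : 0 < (N:ℝ) - 2 := by linarith
  have hαp : 0 < α := Real.rpow_pos_of_pos (by positivity) _
  refine ⟨φ 0 * (2 / (α * (N - 2))), fun j => -(g j) / (α * (N - 2)), fun ξ => ?_⟩
  have h1 := hzero ξ
  have hsum : ∑ j : Fin N, -(g j) / (α * (N - 2)) * Zj N j ξ = inner ℝ g ξ * rho N (‖ξ‖ ^ 2) := by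
    rw [← sum_aa, Finset.sum_mul]
    refine Finset.sum_congr rfl fun j _ => ?_
    unfold Zj
    rw [bubble_fderiv, ← hα]
    simp only [EuclideanSpace.inner_single_right]
    simp
    field_simp
  have hZ0 : φ 0 * (2 / (α * (N - 2))) * Z0 N ξ = φ 0 * ((1 - ‖ξ‖ ^ 2) * rho N (‖ξ‖ ^ 2)) := by
    unfold Z0
    rw [bubble_fderiv, bubble_rho, ← hα, real_inner_self_eq_norm_sq]
    field_simp
    ring
  rw [hsum, hZ0]
  linarith
end
end

section
/- Let N ≥ 5 be an integer, γ = (N-2)/2, and define T₁(w₀)(ξ) = Σ_{i,j=1}^N ξ_i ξ_j ∂²w₀/∂ξ_i∂ξ_j (ξ) + 2(1+γ) ξ·∇w₀(ξ) + γ(1+γ) w₀(ξ). Then ∫_{ℝ^N} Z₀(ξ) T₁(w₀)(ξ) dξ = 0. -/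
noncomputable section
open Real MeasureTheory

/-- The second partial derivative `∂²f/∂ξ_i∂ξ_j`. -/
def d2 {N : ℕ} (f : EuclideanSpace ℝ (Fin N) → ℝ) (i j : Fin N)
    (ξ : EuclideanSpace ℝ (Fin N)) : ℝ :=
  fderiv ℝ (fun y => fderiv ℝ f y (EuclideanSpace.single j 1)) ξ (EuclideanSpace.single i 1)

theorem aux_rpow {N : ℕ} (c : ℝ) (ξ : EuclideanSpace ℝ (Fin N)) :
    HasFDerivAt (fun y : EuclideanSpace ℝ (Fin N) => (1 + ‖y‖ ^ 2) ^ c)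
      ((c * (1 + ‖ξ‖ ^ 2) ^ (c - 1)) • (2 • (innerSL ℝ ξ))) ξ := by
  have h1 : HasFDerivAt (fun y : EuclideanSpace ℝ (Fin N) => 1 + ‖y‖ ^ 2)
      (2 • (innerSL ℝ ξ)) ξ :=
    ((hasStrictFDerivAt_norm_sq ξ).hasFDerivAt).const_add 1
  exact h1.rpow_const (Or.inl (by positivity))

theorem aux_fderiv {N : ℕ} (ξ v : EuclideanSpace ℝ (Fin N)) :
    fderiv ℝ (bubble N) ξ v =
      ((N : ℝ) * ((N : ℝ) - 2)) ^ (((N : ℝ) - 2) / 4) *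
        (-(((N : ℝ) - 2) / 2) * (1 + ‖ξ‖ ^ 2) ^ (-(((N : ℝ) - 2) / 2) - 1) * (2 * inner ℝ ξ v)) := by
  have h := (aux_rpow (-(((N : ℝ) - 2) / 2)) ξ).const_mul
    (((N : ℝ) * ((N : ℝ) - 2)) ^ (((N : ℝ) - 2) / 4))
  have h2 : HasFDerivAt (bubble N) _ ξ := h
  rw [h2.fderiv]
  simp

theorem aux_gen {N : ℕ} (ξ v : EuclideanSpace ℝ (Fin N)) (j : Fin N) (K c : ℝ) :
    fderiv ℝ (fun y : EuclideanSpace ℝ (Fin N) => K * ((1 + ‖y‖ ^ 2) ^ c * y j)) ξ v =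
      K * ((1 + ‖ξ‖ ^ 2) ^ c * v j +
        ξ j * (c * (1 + ‖ξ‖ ^ 2) ^ (c - 1) * (2 * inner ℝ ξ v))) := by
  have hp : HasFDerivAt (fun y : EuclideanSpace ℝ (Fin N) => y j)
      (EuclideanSpace.proj j : EuclideanSpace ℝ (Fin N) →L[ℝ] ℝ) ξ :=
    (EuclideanSpace.proj j : EuclideanSpace ℝ (Fin N) →L[ℝ] ℝ).hasFDerivAt
  have h : HasFDerivAt (fun y : EuclideanSpace ℝ (Fin N) => K * ((1 + ‖y‖ ^ 2) ^ c * y j)) _ ξ :=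
    ((aux_rpow c ξ).mul hp).const_mul K
  rw [h.fderiv]
  rw [mul_add]
  simp

theorem aux_d2 {N : ℕ} (ξ : EuclideanSpace ℝ (Fin N)) (i j : Fin N) :
    d2 (bubble N) i j ξ =
      ((N : ℝ) * ((N : ℝ) - 2)) ^ (((N : ℝ) - 2) / 4) * (-(((N : ℝ) - 2) / 2)) * 2 *
        ((1 + ‖ξ‖ ^ 2) ^ (-(((N : ℝ) - 2) / 2) - 1) * (if i = j then 1 else 0)
        + ξ j * ((-(((N : ℝ) - 2) / 2) - 1) *
          (1 + ‖ξ‖ ^ 2) ^ (-(((N : ℝ) - 2) / 2) - 1 - 1) * (2 * ξ i))) := by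
  unfold d2
  have e : (fun y => fderiv ℝ (bubble N) y (EuclideanSpace.single j 1)) =
      fun y => (((N : ℝ) * ((N : ℝ) - 2)) ^ (((N : ℝ) - 2) / 4) * (-(((N : ℝ) - 2) / 2)) * 2) *
        ((1 + ‖y‖ ^ 2) ^ (-(((N : ℝ) - 2) / 2) - 1) * y j) := by
    funext y
    rw [aux_fderiv]
    simp [EuclideanSpace.inner_single_right]
    ring
  rw [e, aux_gen]
  simp only [EuclideanSpace.inner_single_right, EuclideanSpace.single_apply, eq_comm (a := j)]
  simp

theorem aux_sum {N : ℕ} (ξ : EuclideanSpace ℝ (Fin N)) (K a b : ℝ) :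
    ∑ i : Fin N, ∑ j : Fin N, ξ i * ξ j *
      (K * (a * (if i = j then 1 else 0) + ξ j * (b * (2 * ξ i)))) =
    K * (a * ‖ξ‖ ^ 2 + 2 * b * (‖ξ‖ ^ 2) ^ 2) := by
  have hn : ‖ξ‖ ^ 2 = ∑ i, ξ i ^ 2 := by
    rw [EuclideanSpace.norm_sq_eq]; simp
  rw [hn]
  have : ∀ i j : Fin N, ξ i * ξ j * (K * (a * (if i = j then 1 else 0) + ξ j * (b * (2 * ξ i))))
      = (if i = j then K * a * (ξ i * ξ j) else 0) + 2 * K * b * (ξ i ^ 2 * ξ j ^ 2) := by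
    intro i j
    split_ifs <;> ring
  simp_rw [this, Finset.sum_add_distrib, ← Finset.mul_sum, ← Finset.sum_mul]
  simp [← Finset.mul_sum, ← pow_two]
  ring

theorem aux_lim (N : ℕ) (hN : 5 ≤ N) (C : ℝ) :
    Filter.Tendsto (fun r : ℝ => C * (r ^ N * (1 - r ^ 2) ^ 2 / (1 + r ^ 2) ^ N))
      Filter.atTop (nhds 0) := by
  rw [← mul_zero C]
  refine Filter.Tendsto.const_mul C ?_
  refine squeeze_zero' (g := fun r : ℝ => r⁻¹) ?_ ?_ tendsto_inv_atTop_zero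
  · filter_upwards [Filter.eventually_ge_atTop 0] with r hr
    positivity
  · filter_upwards [Filter.eventually_ge_atTop 1] with r hr
    obtain ⟨k, rfl⟩ := Nat.exists_eq_add_of_le hN
    rw [div_le_iff₀ (by positivity), inv_mul_eq_div, le_div_iff₀ (by positivity)]
    have h1 : r ^ k ≤ (1 + r ^ 2) ^ k := pow_le_pow_left₀ (by positivity) (by nlinarith) k
    have h2 : (1 - r ^ 2) ^ 2 ≤ (1 + r ^ 2) ^ 2 := by nlinarith
    have h3 : (r ^ 2) ^ 3 ≤ (1 + r ^ 2) ^ 3 := pow_le_pow_left₀ (by positivity) (by linarith) 3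
    calc r ^ (5 + k) * (1 - r ^ 2) ^ 2 * r = (r ^ 2) ^ 3 * r ^ k * (1 - r ^ 2) ^ 2 := by ring
      _ ≤ (1 + r ^ 2) ^ 3 * (1 + r ^ 2) ^ k * (1 + r ^ 2) ^ 2 := by gcongr
      _ = _ := by ring

theorem aux_deriv (N : ℕ) (hN : 5 ≤ N) (C r : ℝ) :
    HasDerivAt (fun r : ℝ => C * (r ^ N * (1 - r ^ 2) ^ 2 / (1 + r ^ 2) ^ N))
      (r ^ (N - 1) * (2 * C * ((1 - r ^ 2) * ((N : ℝ) / 2 * (1 - r ^ 2) ^ 2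
        - 2 * r ^ 2 * (1 + r ^ 2)) / (1 + r ^ 2) ^ (N + 1)))) r := by
  obtain ⟨k, rfl⟩ := Nat.exists_eq_add_of_le hN
  have hp : (1 + r ^ 2) ≠ 0 := by positivity
  have h1 := (((hasDerivAt_id r).pow 2).const_sub 1).pow 2
  have h2 := (((hasDerivAt_id r).pow 2).const_add 1).pow (5 + k)
  have h := ((((hasDerivAt_id r).pow (5 + k)).mul h1).div h2 (by simp only [Pi.pow_apply, id]; exact pow_ne_zero _ hp)).const_mul C
  refine h.congr_deriv ?_
  simp only [id, Pi.pow_apply, Pi.mul_apply, show 5 + k - 1 = 4 + k by omega]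
  push_cast
  field_simp
  ring

theorem statement7 (N : ℕ) (hN : 5 ≤ N) :
    let γ : ℝ := ((N : ℝ) - 2) / 2
    let T1 : EuclideanSpace ℝ (Fin N) → ℝ := fun ξ =>
      (∑ i : Fin N, ∑ j : Fin N, ξ i * ξ j * d2 (bubble N) i j ξ)
        + 2 * (1 + γ) * fderiv ℝ (bubble N) ξ ξ + γ * (1 + γ) * bubble N ξ
    (∫ ξ : EuclideanSpace ℝ (Fin N), Z0 N ξ * T1 ξ) = 0 := by
  intro γ T1
  set A : ℝ := ((N : ℝ) * ((N : ℝ) - 2)) ^ (((N : ℝ) - 2) / 4) with hA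
  let C : ℝ := (A * γ) ^ 2 / 2
  let h : ℝ → ℝ := fun r => 2 * C * ((1 - r ^ 2) * ((N : ℝ) / 2 * (1 - r ^ 2) ^ 2
        - 2 * r ^ 2 * (1 + r ^ 2)) / (1 + r ^ 2) ^ (N + 1))
  have key : ∀ ξ, Z0 N ξ * T1 ξ = h ‖ξ‖ := by
    intro ξ
    have hs : (0 : ℝ) < 1 + ‖ξ‖ ^ 2 := by positivity
    have e1 : (1 + ‖ξ‖ ^ 2) ^ (-(((N : ℝ) - 2) / 2) - 1) =
        (1 + ‖ξ‖ ^ 2) ^ (-(((N : ℝ) - 2) / 2) - 1 - 1) * (1 + ‖ξ‖ ^ 2) := by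
      rw [← Real.rpow_add_one hs.ne']; congr 1; ring
    have e0 : (1 + ‖ξ‖ ^ 2) ^ (-(((N : ℝ) - 2) / 2)) =
        (1 + ‖ξ‖ ^ 2) ^ (-(((N : ℝ) - 2) / 2) - 1 - 1) * (1 + ‖ξ‖ ^ 2) ^ 2 := by
      rw [← Real.rpow_add_natCast hs.ne']; congr 1; push_cast; ring
    have e2 : (1 + ‖ξ‖ ^ 2) ^ (-(((N : ℝ) - 2) / 2) - 1 - 1) *
        (1 + ‖ξ‖ ^ 2) ^ (-(((N : ℝ) - 2) / 2) - 1 - 1) * (1 + ‖ξ‖ ^ 2) ^ (N + 2) = 1 := by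
      rw [← Real.rpow_add hs, ← Real.rpow_add_natCast hs.ne']
      convert Real.rpow_zero _ using 2
      push_cast; ring
    simp only [T1, Z0, aux_d2, aux_fderiv, real_inner_self_eq_norm_sq]
    rw [aux_sum]
    simp only [bubble, e1, e0, ← hA, h, C, γ]
    generalize (1 + ‖ξ‖ ^ 2) ^ (-(((N : ℝ) - 2) / 2) - 1 - 1) = P at *
    rw [mul_div_assoc', eq_div_iff (by positivity)]
    generalize ‖ξ‖ = r at *
    rw [pow_succ] at e2
    generalize (1 + r ^ 2) ^ (N + 1) = Q at *
    linear_combination (A * (((N : ℝ) - 2) / 2)) ^ 2 * ((1 - r ^ 2) * ((N : ℝ) / 2 * (1 - r ^ 2) ^ 2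
        - 2 * r ^ 2 * (1 + r ^ 2))) * e2
  simp_rw [key]
  have : Nontrivial (EuclideanSpace ℝ (Fin N)) := by
    have : Nonempty (Fin N) := ⟨⟨0, by omega⟩⟩
    infer_instance
  rw [integral_fun_norm_addHaar volume h]
  have hI : ∫ y in Set.Ioi (0 : ℝ), y ^ (Module.finrank ℝ (EuclideanSpace ℝ (Fin N)) - 1) • h y = 0 := by
    simp only [finrank_euclideanSpace_fin, smul_eq_mul]
    by_cases hi : IntegrableOn (fun y => y ^ (N - 1) * h y) (Set.Ioi 0)
    · rw [integral_Ioi_of_hasDerivAt_of_tendsto' (fun x _ => aux_deriv N hN C x) hi (aux_lim N hN C)]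
      simp [show N ≠ 0 by omega]
    · exact integral_undef hi
  rw [hI]; simp
end
end

section
/- For every integer N ≥ 3, ∫_{ℝ^N} w₀(ξ)^p ln(w₀(ξ)) Z₀(ξ) dξ = (N/(p+1)²) ∫_{ℝ^N} w₀(ξ)^{p+1} dξ, and both integrals are finite. -/
noncomputable section
open Real MeasureTheory

lemma aux_log_bound (a b r : ℝ) : |a + b * Real.log (1 + r ^ 2)| ≤ (|a| + |b|) * (1 + r ^ 2) := by
  have h1 : (1 : ℝ) ≤ 1 + r ^ 2 := by nlinarith [sq_nonneg r]
  have h2 : 0 ≤ Real.log (1 + r ^ 2) := Real.log_nonneg h1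
  have h3 : Real.log (1 + r ^ 2) ≤ 1 + r ^ 2 := by
    linarith [Real.log_le_sub_one_of_pos (show (0 : ℝ) < 1 + r ^ 2 by linarith)]
  calc |a + b * Real.log (1 + r ^ 2)| ≤ |a| + |b * Real.log (1 + r ^ 2)| := abs_add_le _ _
    _ = |a| + |b| * Real.log (1 + r ^ 2) := by rw [abs_mul, abs_of_nonneg h2]
    _ ≤ |a| * (1 + r ^ 2) + |b| * (1 + r ^ 2) := by
        have := mul_le_mul_of_nonneg_left h3 (abs_nonneg b)
        have := mul_le_mul_of_nonneg_left h1 (abs_nonneg a)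
        linarith
    _ = _ := by ring

lemma aux_int0 (N : ℕ) (hN : 3 ≤ N) :
    Integrable (fun ξ : EuclideanSpace ℝ (Fin N) => ((1 + ‖ξ‖ ^ 2) ^ (N - 1))⁻¹) := by
  have hN' : (3 : ℝ) ≤ N := by exact_mod_cast hN
  have h := integrable_rpow_neg_one_add_norm_sq (E := EuclideanSpace ℝ (Fin N)) (μ := volume)
    (r := 2 * (N : ℝ) - 2) (by simp; linarith)
  refine h.congr (Filter.Eventually.of_forall fun ξ => ?_)
  have hs : (0 : ℝ) < 1 + ‖ξ‖ ^ 2 := by positivity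
  simp only
  rw [← Real.rpow_natCast (1 + ‖ξ‖ ^ 2) (N - 1), ← Real.rpow_neg hs.le, Nat.cast_sub (by omega)]
  congr 1
  push_cast
  ring

/-- integrability of the radial model -/
lemma aux_int (N : ℕ) (hN : 3 ≤ N) (a b c d : ℝ) :
    Integrable (fun ξ : EuclideanSpace ℝ (Fin N) => ((1 + ‖ξ‖ ^ 2) ^ N)⁻¹ *
      ((a + b * Real.log (1 + ‖ξ‖ ^ 2)) * ((1 - ‖ξ‖ ^ 2) / (1 + ‖ξ‖ ^ 2)) * c + d)) := by
  refine ((aux_int0 N hN).const_mul ((|a| + |b|) * |c| + |d|)).mono' ?_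
    (Filter.Eventually.of_forall fun ξ => ?_)
  · apply Measurable.aestronglyMeasurable
    fun_prop
  have h1 : (1 : ℝ) ≤ 1 + ‖ξ‖ ^ 2 := by nlinarith [sq_nonneg ‖ξ‖]
  have hlog := aux_log_bound a b ‖ξ‖
  have hq : |(1 - ‖ξ‖ ^ 2) / (1 + ‖ξ‖ ^ 2)| ≤ 1 := by
    rw [abs_div, abs_of_pos (show (0:ℝ) < 1 + ‖ξ‖ ^ 2 by linarith), div_le_one (by linarith), abs_le]
    constructor <;> nlinarith [sq_nonneg ‖ξ‖]
  generalize Real.log (1 + ‖ξ‖ ^ 2) = l at *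
  generalize (1 - ‖ξ‖ ^ 2) / (1 + ‖ξ‖ ^ 2) = q at *
  generalize 1 + ‖ξ‖ ^ 2 = s at *
  have hs : 0 < s := by linarith
  have hb : |(a + b * l) * q * c + d| ≤ ((|a| + |b|) * |c| + |d|) * s := by
    calc |(a + b * l) * q * c + d| ≤ |a + b * l| * |q| * |c| + |d| := by
          rw [← abs_mul, ← abs_mul]; exact abs_add_le _ _
      _ ≤ ((|a| + |b|) * s) * 1 * |c| + |d| * s := by
          have := mul_le_mul_of_nonneg_left h1 (abs_nonneg d)
          gcongr
          linarith
      _ = _ := by ring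
  rw [Real.norm_eq_abs, abs_mul, abs_of_pos (by positivity : 0 < (s ^ N)⁻¹)]
  obtain ⟨k, rfl⟩ : ∃ k, N = k + 1 := ⟨N - 1, by omega⟩
  calc (s ^ (k+1))⁻¹ * |(a + b * l) * q * c + d|
      ≤ (s ^ (k+1))⁻¹ * (((|a| + |b|) * |c| + |d|) * s) := by gcongr
    _ = ((|a| + |b|) * |c| + |d|) * (s ^ (k + 1 - 1))⁻¹ := by
      simp only [Nat.add_sub_cancel]
      field_simp
      ring

lemma aux_tendsto (N : ℕ) (hN : 3 ≤ N) (a b : ℝ) :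
    Filter.Tendsto (fun r : ℝ => r ^ N * (((1 + r ^ 2) ^ N)⁻¹ * (a + b * Real.log (1 + r ^ 2))))
      Filter.atTop (nhds 0) := by
  have h0 : Filter.Tendsto (fun r : ℝ => (|a| + |b|) * r⁻¹) Filter.atTop (nhds 0) := by
    simpa using tendsto_inv_atTop_zero.const_mul (|a| + |b|)
  refine squeeze_zero_norm' ?_ h0
  filter_upwards [Filter.eventually_ge_atTop 1] with r hr
  have hlog := aux_log_bound a b r
  have hs : (0 : ℝ) < 1 + r ^ 2 := by positivity
  have hr0 : 0 < r := by linarith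
  have e : r ^ N * (((1 + r ^ 2) ^ N)⁻¹ * (a + b * Real.log (1 + r ^ 2)))
      = (r / (1 + r ^ 2)) ^ N * (a + b * Real.log (1 + r ^ 2)) := by
    rw [div_pow]; field_simp
  rw [e, Real.norm_eq_abs, abs_mul, abs_of_nonneg (by positivity)]
  have hq : r / (1 + r ^ 2) ≤ 1 := by
    rw [div_le_one hs]; nlinarith
  have hp : (r / (1 + r ^ 2)) ^ N ≤ (r / (1 + r ^ 2)) ^ 3 :=
    pow_le_pow_of_le_one (by positivity) hq hN
  calc (r / (1 + r ^ 2)) ^ N * |a + b * Real.log (1 + r ^ 2)|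
      ≤ (r / (1 + r ^ 2)) ^ 3 * ((|a| + |b|) * (1 + r ^ 2)) := by gcongr
    _ = (|a| + |b|) * (r ^ 3 / (1 + r ^ 2) ^ 2) := by field_simp
    _ ≤ (|a| + |b|) * r⁻¹ := by
      gcongr
      rw [div_le_iff₀ (by positivity), ← div_eq_inv_mul, le_div_iff₀ hr0]
      nlinarith [sq_nonneg r]

lemma aux_zero (N : ℕ) (hN : 3 ≤ N) (L m : ℝ) :
    ∫ ξ : EuclideanSpace ℝ (Fin N), ((1 + ‖ξ‖ ^ 2) ^ N)⁻¹ *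
      ((L + (-m) * Real.log (1 + ‖ξ‖ ^ 2)) * ((1 - ‖ξ‖ ^ 2) / (1 + ‖ξ‖ ^ 2)) * m + (-(m ^ 2 / N)))
      = 0 := by
  have hN0 : (N : ℝ) ≠ 0 := by
    have : N ≠ 0 := by omega
    exact_mod_cast this
  have : Nontrivial (EuclideanSpace ℝ (Fin N)) := by
    apply Module.nontrivial_of_finrank_pos (R := ℝ)
    simp; omega
  have hint := aux_int N hN L (-m) m (-(m ^ 2 / N))
  set k : ℝ → ℝ := fun r => ((1 + r ^ 2) ^ N)⁻¹ *
      ((L + (-m) * Real.log (1 + r ^ 2)) * ((1 - r ^ 2) / (1 + r ^ 2)) * m + (-(m ^ 2 / N))) with hk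
  have hint' := (integrable_fun_norm_addHaar (μ := (volume : Measure (EuclideanSpace ℝ (Fin N))))
    (f := k)).1 hint
  change ∫ ξ : EuclideanSpace ℝ (Fin N), k ‖ξ‖ = 0
  rw [integral_fun_norm_addHaar]
  have hF := integral_Ioi_of_hasDerivAt_of_tendsto' (a := 0)
    (f := fun r : ℝ => r ^ N * (((1 + r ^ 2) ^ N)⁻¹ * ((m / N * L - m ^ 2 / N ^ 2)
      + (- (m ^ 2 / N)) * Real.log (1 + r ^ 2)))) ?_ hint' (aux_tendsto N hN _ _)
  · rw [hF]
    have : N ≠ 0 := by omega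
    simp [this]
  intro r _
  have hs : (0 : ℝ) < 1 + r ^ 2 := by positivity
  have hsd : HasDerivAt (fun r : ℝ => 1 + r ^ 2) (2 * r) r := by
    simpa using (hasDerivAt_pow 2 r).const_add 1
  have h := (hasDerivAt_pow N r).mul (((hsd.pow N).inv (pow_pos hs N).ne').mul
    (((hsd.log hs.ne').const_mul (-(m ^ 2 / N))).const_add (m / N * L - m ^ 2 / N ^ 2)))
  refine h.congr_deriv ?_
  simp only [hk, finrank_euclideanSpace_fin, smul_eq_mul, Pi.mul_apply, Pi.pow_apply, Pi.inv_apply]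
  generalize Real.log (1 + r ^ 2) = l
  obtain ⟨j, rfl⟩ : ∃ k, N = k + 1 := ⟨N - 1, by omega⟩
  simp only [Nat.add_sub_cancel]
  field_simp
  ring

lemma aux_bubble_Z (N : ℕ) (ξ : EuclideanSpace ℝ (Fin N)) :
    Z0 N ξ = ((N : ℝ) - 2) / 2 * bubble N ξ * ((1 - ‖ξ‖ ^ 2) / (1 + ‖ξ‖ ^ 2)) := by
  have hs : (0 : ℝ) < 1 + ‖ξ‖ ^ 2 := by positivity
  have h1 : HasFDerivAt (fun x : EuclideanSpace ℝ (Fin N) => 1 + ‖x‖ ^ 2) (2 • innerSL ℝ ξ) ξ :=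
    ((hasStrictFDerivAt_norm_sq ξ).hasFDerivAt).const_add 1
  have h2 := (h1.rpow_const (p := -(((N : ℝ) - 2) / 2)) (Or.inl hs.ne')).const_mul
    (((N : ℝ) * ((N : ℝ) - 2)) ^ (((N : ℝ) - 2) / 4))
  have h3 : HasFDerivAt (bubble N) _ ξ := h2
  unfold Z0
  rw [h3.fderiv]
  simp only [bubble, smul_apply, innerSL_apply_apply, smul_eq_mul,
    real_inner_self_eq_norm_sq, nsmul_eq_mul]
  rw [Real.rpow_sub_one hs.ne']
  field_simp
  push_cast
  ring

theorem statement8 (N : ℕ) (hN : 3 ≤ N) :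
    let p : ℝ := ((N : ℝ) + 2) / ((N : ℝ) - 2)
    Integrable
      (fun ξ : EuclideanSpace ℝ (Fin N) => bubble N ξ ^ p * Real.log (bubble N ξ) * Z0 N ξ) ∧
    Integrable (fun ξ : EuclideanSpace ℝ (Fin N) => bubble N ξ ^ (p + 1)) ∧
    (∫ ξ : EuclideanSpace ℝ (Fin N), bubble N ξ ^ p * Real.log (bubble N ξ) * Z0 N ξ)
      = (N : ℝ) / (p + 1) ^ 2 * ∫ ξ : EuclideanSpace ℝ (Fin N), bubble N ξ ^ (p + 1) := by
  intro p
  have hN' : (3 : ℝ) ≤ N := by exact_mod_cast hN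
  have hN2 : (N : ℝ) - 2 ≠ 0 := by linarith
  set m : ℝ := ((N : ℝ) - 2) / 2 with hm
  have hm0 : 0 < m := by rw [hm]; linarith
  set α : ℝ := ((N : ℝ) * ((N : ℝ) - 2)) ^ (((N : ℝ) - 2) / 4) with hα
  have hα0 : 0 < α := by
    apply Real.rpow_pos_of_pos
    apply mul_pos <;> linarith
  have hp : p + 1 = N / m := by
    simp only [p, hm]
    field_simp
    ring
  have hb : ∀ ξ : EuclideanSpace ℝ (Fin N), bubble N ξ = α * (1 + ‖ξ‖ ^ 2) ^ (-m) := fun ξ => rfl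
  have hbpos : ∀ ξ : EuclideanSpace ℝ (Fin N), 0 < bubble N ξ := fun ξ => by
    rw [hb]; positivity
  have e2 : ∀ ξ : EuclideanSpace ℝ (Fin N),
      bubble N ξ ^ (p + 1) = α ^ (p + 1) * ((1 + ‖ξ‖ ^ 2) ^ N)⁻¹ := fun ξ => by
    have hs : (0 : ℝ) < 1 + ‖ξ‖ ^ 2 := by positivity
    rw [hb, Real.mul_rpow hα0.le (by positivity), ← Real.rpow_mul hs.le, hp,
      show -m * (N / m) = -(N : ℝ) by field_simp, Real.rpow_neg hs.le, Real.rpow_natCast]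
  have e1 : ∀ ξ : EuclideanSpace ℝ (Fin N), bubble N ξ ^ p * Real.log (bubble N ξ) * Z0 N ξ
      = α ^ (p + 1) * (((1 + ‖ξ‖ ^ 2) ^ N)⁻¹ * ((Real.log α + (-m) * Real.log (1 + ‖ξ‖ ^ 2)) *
        ((1 - ‖ξ‖ ^ 2) / (1 + ‖ξ‖ ^ 2)) * m + 0)) := fun ξ => by
    have hs : (0 : ℝ) < 1 + ‖ξ‖ ^ 2 := by positivity
    have hl : Real.log (bubble N ξ) = Real.log α + (-m) * Real.log (1 + ‖ξ‖ ^ 2) := by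
      rw [hb, Real.log_mul hα0.ne' (by positivity), Real.log_rpow hs]
    have h := e2 ξ
    rw [Real.rpow_add_one (hbpos ξ).ne'] at h
    rw [aux_bubble_Z, hl, ← hm]
    linear_combination ((Real.log α + (-m) * Real.log (1 + ‖ξ‖ ^ 2)) *
        ((1 - ‖ξ‖ ^ 2) / (1 + ‖ξ‖ ^ 2)) * m) * h
  have i1 := aux_int N hN (Real.log α) (-m) m 0
  have i2 : Integrable (fun ξ : EuclideanSpace ℝ (Fin N) => ((1 + ‖ξ‖ ^ 2) ^ N)⁻¹) := by
    simpa using aux_int N hN 0 0 0 1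
  have hz := aux_zero N hN (Real.log α) m
  simp only [e1, e2]
  refine ⟨i1.const_mul _, i2.const_mul _, ?_⟩
  rw [integral_const_mul, integral_const_mul]
  have hsub := integral_sub i1 (i2.const_mul (m ^ 2 / N))
  rw [integral_const_mul] at hsub
  have hz' : (∫ ξ : EuclideanSpace ℝ (Fin N), (((1 + ‖ξ‖ ^ 2) ^ N)⁻¹ *
      ((Real.log α + (-m) * Real.log (1 + ‖ξ‖ ^ 2)) *
        ((1 - ‖ξ‖ ^ 2) / (1 + ‖ξ‖ ^ 2)) * m + 0) - m ^ 2 / N * ((1 + ‖ξ‖ ^ 2) ^ N)⁻¹)) = 0 := by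
    refine Eq.trans ?_ hz
    congr 1
    ext ξ
    ring
  rw [hz'] at hsub
  have hc : (N : ℝ) / (p + 1) ^ 2 = m ^ 2 / N := by
    rw [hp]
    have : (N : ℝ) ≠ 0 := by linarith
    field_simp
  rw [hc]
  linear_combination (-(α ^ (p + 1))) * hsub
end
end

section
/- For every integer N ≥ 5 and every fixed index j ∈ {1,…,N}, the function ξ ↦ ξ_j (∂w₀/∂ξ_j)(ξ) Z₀(ξ) is integrable on ℝ^N and ∫_{ℝ^N} ξ_j (∂w₀/∂ξ_j)(ξ) Z₀(ξ) dξ > 0. -/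
noncomputable section
open Real MeasureTheory

lemma b_fderiv (N : ℕ) (ξ v : EuclideanSpace ℝ (Fin N)) :
    fderiv ℝ (bubble N) ξ v =
      -(((N : ℝ) - 2)) * ((N : ℝ) * ((N : ℝ) - 2)) ^ (((N : ℝ) - 2) / 4) *
        (1 + ‖ξ‖ ^ 2) ^ (-((N : ℝ) / 2)) * inner ℝ ξ v := by
  have h1 : HasFDerivAt (fun x : EuclideanSpace ℝ (Fin N) => 1 + ‖x‖ ^ 2)
      (2 • (innerSL ℝ ξ)) ξ := (hasStrictFDerivAt_norm_sq ξ).hasFDerivAt.const_add 1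
  have hp : (1 + ‖ξ‖ ^ 2) ≠ 0 := by positivity
  have h2 := (h1.rpow_const (p := -(((N : ℝ) - 2) / 2)) (Or.inl hp)).const_mul
    (((N : ℝ) * ((N : ℝ) - 2)) ^ (((N : ℝ) - 2) / 4))
  have h3 : HasFDerivAt (bubble N) _ ξ := h2
  rw [h3.fderiv]
  have : -(((N : ℝ) - 2) / 2) - 1 = -((N : ℝ) / 2) := by ring
  rw [this]
  simp
  ring

lemma Z0_eq (N : ℕ) (ξ : EuclideanSpace ℝ (Fin N)) :
    Z0 N ξ = (((N : ℝ) - 2) / 2) * ((N : ℝ) * ((N : ℝ) - 2)) ^ (((N : ℝ) - 2) / 4) *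
        (1 + ‖ξ‖ ^ 2) ^ (-((N : ℝ) / 2)) * (1 - ‖ξ‖ ^ 2) := by
  have hp : 0 < (1 + ‖ξ‖ ^ 2) := by positivity
  have : (1 + ‖ξ‖ ^ 2) ^ (-(((N : ℝ) - 2) / 2)) =
      (1 + ‖ξ‖ ^ 2) ^ (-((N : ℝ) / 2)) * (1 + ‖ξ‖ ^ 2) := by
    rw [← Real.rpow_add_one hp.ne']; congr 1; ring
  rw [Z0, b_fderiv, bubble, this, real_inner_self_eq_norm_sq]
  ring

lemma integrand_eq (N : ℕ) (j : Fin N) (ξ : EuclideanSpace ℝ (Fin N)) :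
    ξ j * fderiv ℝ (bubble N) ξ (EuclideanSpace.single j 1) * Z0 N ξ =
      ((((N : ℝ) - 2)) ^ 2 / 2 * (((N : ℝ) * ((N : ℝ) - 2)) ^ (((N : ℝ) - 2) / 4)) ^ 2) *
      ((ξ j) ^ 2 * ((‖ξ‖ ^ 2 - 1) / (1 + ‖ξ‖ ^ 2) ^ N)) := by
  have hp : 0 < (1 + ‖ξ‖ ^ 2) := by positivity
  have : ((1 + ‖ξ‖ ^ 2) ^ N)⁻¹ = ((1 + ‖ξ‖ ^ 2) ^ (-((N : ℝ) / 2))) ^ 2 := by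
    rw [← Real.rpow_natCast _ N, ← Real.rpow_natCast (_ ^ (-((N : ℝ) / 2))) 2, ← Real.rpow_mul hp.le, ← Real.rpow_neg hp.le]
    congr 1; push_cast; ring
  rw [Z0_eq, b_fderiv, div_eq_mul_inv (‖ξ‖ ^ 2 - 1), this, EuclideanSpace.inner_single_right]
  simp
  ring

lemma coord_le (N : ℕ) (j : Fin N) (ξ : EuclideanSpace ℝ (Fin N)) : (ξ j) ^ 2 ≤ ‖ξ‖ ^ 2 := by
  rw [EuclideanSpace.real_norm_sq_eq]
  exact Finset.single_le_sum (f := fun i => (ξ i) ^ 2) (fun i _ => sq_nonneg _) (Finset.mem_univ j)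

lemma dom_int (N : ℕ) (hN : 5 ≤ N) (g : EuclideanSpace ℝ (Fin N) → ℝ) (hg : Continuous g)
    (hb : ∀ ξ, |g ξ| ≤ (1 + ‖ξ‖ ^ 2) ^ 2) :
    Integrable (fun ξ : EuclideanSpace ℝ (Fin N) => g ξ / (1 + ‖ξ‖ ^ 2) ^ N) := by
  have hN' : (5 : ℝ) ≤ N := by exact_mod_cast hN
  have h := integrable_rpow_neg_one_add_norm_sq (E := EuclideanSpace ℝ (Fin N)) (μ := volume)
    (r := 2 * (N : ℝ) - 4) (by simp; linarith)
  refine h.mono' ?_ (Filter.Eventually.of_forall fun ξ => ?_)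
  · refine (hg.div (by fun_prop) fun ξ => ?_).aestronglyMeasurable
    positivity
  · have hp : 0 < (1 + ‖ξ‖ ^ 2) := by positivity
    have e : (1 + ‖ξ‖ ^ 2) ^ (-(2 * (N : ℝ) - 4) / 2) = (1 + ‖ξ‖ ^ 2) ^ 2 / (1 + ‖ξ‖ ^ 2) ^ N := by
      rw [← Real.rpow_natCast _ N, ← Real.rpow_natCast (1 + ‖ξ‖ ^ 2) 2, ← Real.rpow_sub hp]
      congr 1; push_cast; ring
    rw [e, Real.norm_eq_abs, abs_div, abs_of_pos (pow_pos hp N)]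
    gcongr
    exact hb ξ

lemma int_coord (N : ℕ) (hN : 5 ≤ N) (j : Fin N) :
    Integrable (fun ξ : EuclideanSpace ℝ (Fin N) =>
      (ξ j) ^ 2 * ((‖ξ‖ ^ 2 - 1) / (1 + ‖ξ‖ ^ 2) ^ N)) := by
  have := dom_int N hN (fun ξ => (ξ j) ^ 2 * (‖ξ‖ ^ 2 - 1)) (by fun_prop) (fun ξ => by
    rw [abs_mul, abs_of_nonneg (sq_nonneg (ξ j)), sq (1 + ‖ξ‖ ^ 2)]
    have := coord_le N j ξ
    have h2 := sq_nonneg ‖ξ‖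
    refine mul_le_mul (by linarith) ?_ (abs_nonneg _) (by positivity)
    rw [abs_le]; constructor <;> linarith)
  simpa only [mul_div_assoc] using this

lemma symm_coord (N : ℕ) (h : ℝ → ℝ) (i j : Fin N) :
    ∫ ξ : EuclideanSpace ℝ (Fin N), (ξ i) ^ 2 * h ‖ξ‖ =
    ∫ ξ : EuclideanSpace ℝ (Fin N), (ξ j) ^ 2 * h ‖ξ‖ := by
  let e := LinearIsometryEquiv.piLpCongrLeft 2 ℝ ℝ (Equiv.swap i j)
  have := e.measurePreserving.integral_comp e.toHomeomorph.measurableEmbedding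
    (fun ξ : EuclideanSpace ℝ (Fin N) => (ξ j) ^ 2 * h ‖ξ‖)
  rw [← this]
  congr 1
  ext ξ
  have : (e ξ) j = ξ i := by simp [e, LinearIsometryEquiv.piLpCongrLeft_apply]
  rw [this, e.norm_map]

lemma radial (N : ℕ) (hN : 5 ≤ N)
    (hL : IntegrableOn (fun y : ℝ => y ^ (N - 1) • (y ^ 2 / (1 + y ^ 2) ^ N)) (Set.Ioi 0))
    (hK : IntegrableOn (fun y : ℝ => y ^ (N - 1) • (y ^ 2 * ((y ^ 2 - 1) / (1 + y ^ 2) ^ N)))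
      (Set.Ioi 0)) :
    0 < ∫ y in Set.Ioi (0 : ℝ), y ^ (N - 1) • (y ^ 2 * ((y ^ 2 - 1) / (1 + y ^ 2) ^ N)) := by
  obtain ⟨k, rfl⟩ : ∃ k, N = k + 5 := ⟨N - 5, by omega⟩
  have hLpos : 0 < ∫ y in Set.Ioi (0 : ℝ),
      y ^ (k + 5 - 1) • (y ^ 2 / (1 + y ^ 2) ^ (k + 5)) := by
    rw [setIntegral_pos_iff_support_of_nonneg_ae _ hL]
    · have : Set.Ioi (0:ℝ) ⊆ (Function.support
        fun y : ℝ => y ^ (k + 5 - 1) • (y ^ 2 / (1 + y ^ 2) ^ (k + 5))) := by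
        intro y hy
        have hy : 0 < y := hy
        simp only [Function.mem_support, smul_eq_mul]
        positivity
      rw [Set.inter_eq_right.mpr this]
      simp
    · filter_upwards [ae_restrict_mem measurableSet_Ioi] with y hy
      have hy : 0 < y := hy
      simp only [Pi.zero_apply, smul_eq_mul]
      positivity
  have hder : ∀ y ∈ Set.Ici (0 : ℝ),
      HasDerivAt (fun y : ℝ => y ^ (k + 7) / (1 + y ^ 2) ^ (k + 4))
      (6 * (y ^ (k + 5 - 1) • (y ^ 2 / (1 + y ^ 2) ^ (k + 5))) -
        ((k : ℝ) + 1) * (y ^ (k + 5 - 1) • (y ^ 2 * ((y ^ 2 - 1) / (1 + y ^ 2) ^ (k + 5))))) y := by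
    intro y _
    have hp : (1 + y ^ 2) ≠ 0 := by positivity
    have h1 : HasDerivAt (fun y : ℝ => (1 + y ^ 2) ^ (k + 4)) _ y :=
      (((hasDerivAt_pow 2 y).const_add 1).pow (k + 4))
    have h2 := (hasDerivAt_pow (k + 7) y).div h1 (pow_ne_zero _ hp)
    refine h2.congr_deriv ?_
    have e1 : k + 5 - 1 = k + 4 := by omega
    have e2 : k + 7 - 1 = k + 6 := by omega
    have e3 : k + 4 - 1 = k + 3 := by omega
    rw [e1, e2, e3]
    simp only [smul_eq_mul]
    field_simp
    push_cast
    ring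
  have hlim : Filter.Tendsto (fun y : ℝ => y ^ (k + 7) / (1 + y ^ 2) ^ (k + 4))
      Filter.atTop (nhds 0) := by
    refine squeeze_zero' ?_ ?_ tendsto_inv_atTop_zero
    · filter_upwards [Filter.eventually_ge_atTop 1] with y hy
      positivity
    · filter_upwards [Filter.eventually_ge_atTop 1] with y hy
      rw [div_le_iff₀ (by positivity), inv_mul_eq_div, le_div_iff₀ (by positivity)]
      calc y ^ (k + 7) * y = y ^ (k + 8) := by ring
        _ ≤ y ^ (2 * (k + 4)) := pow_le_pow_right₀ hy (by omega)
        _ = (y ^ 2) ^ (k + 4) := by rw [pow_mul]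
        _ ≤ _ := by gcongr; linarith
  have hint := (hL.const_mul 6).sub (hK.const_mul ((k : ℝ) + 1))
  have key := integral_Ioi_of_hasDerivAt_of_tendsto' hder hint hlim
  rw [integral_sub (hL.const_mul 6) (hK.const_mul ((k : ℝ) + 1)), integral_const_mul,
    integral_const_mul] at key
  have h0 : (0 : ℝ) ^ (k + 7) = 0 := by simp
  rw [h0, zero_div, sub_zero] at key
  have hk : (0 : ℝ) < k + 1 := by positivity
  refine pos_of_mul_pos_right (a := (k : ℝ) + 1) ?_ hk.le
  linarith

theorem statement9 (N : ℕ) (hN : 5 ≤ N) (j : Fin N) :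
    Integrable (fun ξ : EuclideanSpace ℝ (Fin N) =>
      ξ j * fderiv ℝ (bubble N) ξ (EuclideanSpace.single j 1) * Z0 N ξ) ∧
    0 < ∫ ξ : EuclideanSpace ℝ (Fin N),
      ξ j * fderiv ℝ (bubble N) ξ (EuclideanSpace.single j 1) * Z0 N ξ := by
  have hN' : (5 : ℝ) ≤ N := by exact_mod_cast hN
  simp only [integrand_eq]
  refine ⟨(int_coord N hN j).const_mul _, ?_⟩
  rw [integral_const_mul]
  have h2 : 0 < (N : ℝ) - 2 := by linarith
  have h3 : 0 < (N : ℝ) := by linarith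
  refine mul_pos (by positivity) ?_
  haveI : Nonempty (Fin N) := ⟨j⟩
  haveI : Nontrivial (EuclideanSpace ℝ (Fin N)) := by
    apply Module.nontrivial_of_finrank_pos (R := ℝ); simp; omega
  have hsum : (N : ℝ) * ∫ ξ : EuclideanSpace ℝ (Fin N),
      (ξ j) ^ 2 * ((‖ξ‖ ^ 2 - 1) / (1 + ‖ξ‖ ^ 2) ^ N) =
      ∫ ξ : EuclideanSpace ℝ (Fin N), ‖ξ‖ ^ 2 * ((‖ξ‖ ^ 2 - 1) / (1 + ‖ξ‖ ^ 2) ^ N) := by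
    calc _ = ∑ i : Fin N, ∫ ξ : EuclideanSpace ℝ (Fin N),
          (ξ i) ^ 2 * ((‖ξ‖ ^ 2 - 1) / (1 + ‖ξ‖ ^ 2) ^ N) := by
          rw [Finset.sum_congr rfl fun i _ =>
            symm_coord N (fun r => (r ^ 2 - 1) / (1 + r ^ 2) ^ N) i j]
          simp
      _ = _ := by
          rw [← integral_finset_sum _ fun i _ => int_coord N hN i]
          congr 1; ext ξ
          rw [← Finset.sum_mul, ← EuclideanSpace.real_norm_sq_eq]
  refine pos_of_mul_pos_right (a := (N : ℝ)) ?_ h3.le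
  rw [hsum]
  have hKint : Integrable (fun ξ : EuclideanSpace ℝ (Fin N) =>
      ‖ξ‖ ^ 2 * ((‖ξ‖ ^ 2 - 1) / (1 + ‖ξ‖ ^ 2) ^ N)) := by
    refine (integrable_finset_sum Finset.univ fun i _ => int_coord N hN i).congr
      (Filter.Eventually.of_forall fun ξ => ?_)
    simp only
    rw [← Finset.sum_mul, ← EuclideanSpace.real_norm_sq_eq]
  have hLint := dom_int N hN (fun ξ => ‖ξ‖ ^ 2) (by fun_prop) (fun ξ => by
    rw [abs_of_nonneg (by positivity)]
    nlinarith [sq_nonneg ‖ξ‖])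
  have eK := integral_fun_norm_addHaar (volume : Measure (EuclideanSpace ℝ (Fin N)))
    (fun y : ℝ => y ^ 2 * ((y ^ 2 - 1) / (1 + y ^ 2) ^ N))
  have iK := (integrable_fun_norm_addHaar (volume : Measure (EuclideanSpace ℝ (Fin N)))
    (f := fun y : ℝ => y ^ 2 * ((y ^ 2 - 1) / (1 + y ^ 2) ^ N))).1 hKint
  have iL := (integrable_fun_norm_addHaar (volume : Measure (EuclideanSpace ℝ (Fin N)))
    (f := fun y : ℝ => y ^ 2 / (1 + y ^ 2) ^ N)).1 hLint
  rw [finrank_euclideanSpace_fin] at eK iK iL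
  rw [eK]
  have hv : 0 < (volume : Measure (EuclideanSpace ℝ (Fin N))).real (Metric.ball 0 1) :=
    ENNReal.toReal_pos (Metric.measure_ball_pos _ _ one_pos).ne' measure_ball_lt_top.ne
  have := radial N hN iL iK
  rw [nsmul_eq_mul, smul_eq_mul]
  exact mul_pos h3 (mul_pos hv this)
end
end
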